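/- arXiv:2507.04124 — 6 statements merged into one kernel-verified Lean document; each statement's English description precedes it below -/
import Mathlib

section
/- Let m ≥ 1 and let σ be a permutation of Fin m. For each k with 1 ≤ k ≤ m let N_k(σ) be the number of cycles of σ of length k (fixed points counted as cycles of length 1), so that Σ_k k·N_k(σ) = m. Then the centralizer of σ in the symmetric group S_m is isomorphic, as a group, to the product ∏_{k=1}^{m} ((ℤ/k) ≀ S_{N_k(σ)}), i.e. to ∏_{k=1}^{m} ((Fin N_k(σ) → ZMod k) ⋊ Equiv.Perm (Fin N_k(σ))), where each copy of ℤ/k is generated by the corresponding k-cycle and S_{N_k(σ)} permutes the N_k(σ) cycles of length k. -/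
/-- The action of `Equiv.Perm (Fin t)` on `Fin t → G` by `(σ • h) i = h (σ⁻¹ i)`,
as a homomorphism to the group of multiplicative automorphisms. -/
def permMulAut (G : Type*) [Group G] (t : ℕ) :
    Equiv.Perm (Fin t) →* MulAut (Fin t → G) where
  toFun σ :=
    { toFun := fun h i => h (σ⁻¹ i)
      invFun := fun h i => h (σ i)
      left_inv := fun h => by funext i; simp
      right_inv := fun h => by funext i; simp
      map_mul' := fun h g => rfl }
  map_one' := by ext h i; simp
  map_mul' := fun σ τ => by ext h i; simp [mul_inv_rev]

/-- The wreath product `G ≀ S_t`, i.e. the semidirect product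
`(Fin t → G) ⋊ Equiv.Perm (Fin t)` where a permutation `σ` acts on functions
`h : Fin t → G` by `(σ • h) i = h (σ⁻¹ i)`. -/
abbrev Wreath (G : Type*) [Group G] (t : ℕ) : Type _ :=
  SemidirectProduct (Fin t → G) (Equiv.Perm (Fin t)) (permMulAut G t)

/-- The number of cycles of length `k` of a permutation `σ` of `Fin m`,
where fixed points are counted as cycles of length `1`: the number of points
whose orbit under `σ` has size `k`, divided by `k`. -/
noncomputable def cycleCount {m : ℕ} (σ : Equiv.Perm (Fin m)) (k : ℕ) : ℕ :=
  (Finset.univ.filter fun a : Fin m => Function.minimalPeriod (⇑σ) a = k).card / k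

section Helpers

open Equiv Function

/-- The model set: `N k` cycles of length `k + 1`. -/
abbrev CycModel (m : ℕ) (Q : Fin m → Type) : Type := Σ k : Fin m, Q k × ZMod ((k : ℕ) + 1)

/-- The shift on the model set. -/
def cycShift (m : ℕ) (Q : Fin m → Type) : Perm (CycModel m Q) :=
  Equiv.sigmaCongrRight fun _ => Equiv.prodCongr (Equiv.refl _) (Equiv.addRight 1)

theorem cycShift_pow (m : ℕ) (Q : Fin m → Type) (n : ℕ) (k : Fin m) (i : Q k)
    (x : ZMod ((k : ℕ) + 1)) : (cycShift m Q ^ n) ⟨k, i, x⟩ = ⟨k, i, x + n⟩ := by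
  induction n with
  | zero => simp
  | succ n ih =>
    rw [pow_succ', Perm.mul_apply, ih]
    simp [cycShift, add_assoc]

theorem sigma_ext' {m : ℕ} {Q : Fin m → Type} {k : Fin m} {a b : Q k × ZMod ((k : ℕ) + 1)}
    (h : (⟨k, a⟩ : CycModel m Q) = ⟨k, b⟩) : a = b := by
  cases h; rfl

theorem exists_cycModel {m : ℕ} (σ : Perm (Fin m)) :
    ∃ e : CycModel m (fun k => Fin (cycleCount σ ((k : ℕ) + 1))) ≃ Fin m,
      ∀ t, e (cycShift m _ t) = σ (e t) := by
  classical
  let S := Perm.SameCycle.setoid σ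
  have hper : ∀ a, 0 < minimalPeriod σ a := fun a =>
    minimalPeriod_pos_of_mem_periodicPts (σ.injective.mem_periodicPts a)
  let Q : Fin m → Type := fun k => {c : Quotient S // minimalPeriod σ c.out = (k : ℕ) + 1}
  let F : CycModel m Q → Fin m := fun t => σ^[t.2.2.val] t.2.1.1.out
  have hFp : ∀ t, minimalPeriod σ (F t) = (t.1 : ℕ) + 1 := by
    rintro ⟨k, c, x⟩
    change minimalPeriod σ (σ^[x.val] c.1.out) = _
    rw [minimalPeriod_apply_iterate (σ.injective.mem_periodicPts _)]
    exact c.2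
  have hFinj : Injective F := by
    rintro ⟨k, c, x⟩ ⟨l, d, y⟩ h
    have hkl : k = l := by
      have h1 := hFp ⟨k, c, x⟩
      rw [h, hFp] at h1
      apply Fin.ext; simpa using h1.symm
    subst hkl
    change σ^[x.val] c.1.out = σ^[y.val] d.1.out at h
    have hcd : c = d := by
      apply Subtype.ext
      rw [← Quotient.out_eq c.1, ← Quotient.out_eq d.1]
      apply Quotient.sound
      change σ.SameCycle _ _
      have h' : (σ ^ x.val) c.1.out = (σ ^ y.val) d.1.out := by
        rw [Perm.coe_pow, Perm.coe_pow]; exact h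
      have h1 : σ.SameCycle c.1.out ((σ ^ x.val) c.1.out) := ⟨x.val, by rw [zpow_natCast]⟩
      have h2 : σ.SameCycle d.1.out ((σ ^ y.val) d.1.out) := ⟨y.val, by rw [zpow_natCast]⟩
      rw [h'] at h1
      exact h1.trans h2.symm
    subst hcd
    have hx : x.val < minimalPeriod σ c.1.out := by rw [c.2]; exact ZMod.val_lt x
    have hy : y.val < minimalPeriod σ c.1.out := by rw [c.2]; exact ZMod.val_lt y
    have := (iterate_eq_iterate_iff_of_lt_minimalPeriod hx hy).1 h
    rw [ZMod.val_injective _ this]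
  have hFsurj : Surjective F := by
    intro a
    let c : Quotient S := ⟦a⟧
    have hc : σ.SameCycle c.out a := Quotient.exact (Quotient.out_eq c)
    obtain ⟨n, hn⟩ := hc.exists_nat_pow_eq
    have hle : minimalPeriod σ c.out ≤ m := by
      have := minimalPeriod_le_card (f := σ) (x := c.out)
      simpa using this
    have hp := hper c.out
    refine ⟨⟨⟨minimalPeriod σ c.out - 1, by omega⟩, ⟨c, by simp; omega⟩, (n : ZMod _)⟩, ?_⟩
    change σ^[ZMod.val (n : ZMod (minimalPeriod σ c.out - 1 + 1))] c.out = a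
    rw [ZMod.val_natCast, Nat.sub_add_cancel hp, iterate_mod_minimalPeriod_eq, ← hn, Perm.coe_pow]
  have hFshift : ∀ t, F (cycShift m Q t) = σ (F t) := by
    rintro ⟨k, c, x⟩
    change σ^[(x + 1).val] c.1.out = σ (σ^[x.val] c.1.out)
    rw [← iterate_succ_apply' σ, ← iterate_mod_minimalPeriod_eq (n := x.val.succ), c.2]
    congr 2
    conv_lhs => rw [← ZMod.natCast_zmod_val x]
    rw [← ZMod.val_natCast]
    simp
  have hcard : ∀ k : Fin m, Fintype.card (Q k) = cycleCount σ ((k : ℕ) + 1) := by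
    intro k
    have : (Finset.univ.filter fun a : Fin m => minimalPeriod (⇑σ) a = (k : ℕ) + 1) =
        Finset.univ.image (fun b : Q k × ZMod ((k : ℕ) + 1) => F ⟨k, b⟩) := by
      ext a
      simp only [Finset.mem_filter, Finset.mem_univ, true_and, Finset.mem_image]
      constructor
      · intro h
        obtain ⟨⟨l, b⟩, rfl⟩ := hFsurj a
        rw [hFp] at h
        have : l = k := Fin.ext (by simpa using h)
        subst this
        exact ⟨b, rfl⟩
      · rintro ⟨b, rfl⟩
        exact hFp _
    rw [cycleCount, this, Finset.card_image_of_injective, Finset.card_univ, Fintype.card_prod,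
      ZMod.card, Nat.mul_div_cancel _ (Nat.succ_pos _)]
    intro b b' h
    exact sigma_ext' (hFinj h)
  let g : ∀ k : Fin m, Q k ≃ Fin (cycleCount σ ((k : ℕ) + 1)) :=
    fun k => Fintype.equivFinOfCardEq (hcard k)
  let E : CycModel m (fun k => Fin (cycleCount σ ((k : ℕ) + 1))) ≃ CycModel m Q :=
    Equiv.sigmaCongrRight fun k => Equiv.prodCongr (g k).symm (Equiv.refl _)
  refine ⟨E.trans (Equiv.ofBijective F ⟨hFinj, hFsurj⟩), ?_⟩
  intro t
  exact hFshift (E t)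

/-- The action of the product of wreath products on the model. -/
def wreathToPerm (m : ℕ) (N : Fin m → ℕ) :
    (∀ k : Fin m, Wreath (Multiplicative (ZMod ((k : ℕ) + 1))) (N k)) →*
      Perm (CycModel m fun k => Fin (N k)) :=
  MonoidHom.toHomPerm
  { toFun := fun w t => ⟨t.1, (w t.1).right t.2.1,
      t.2.2 + ((w t.1).left ((w t.1).right t.2.1)).toAdd⟩
    map_one' := by
      funext t
      rcases t with ⟨k, i, x⟩
      change _ = (⟨k, i, x⟩ : CycModel m fun k => Fin (N k))
      simp
    map_mul' := by
      intro w v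
      funext t
      rcases t with ⟨k, i, x⟩
      change _ = (⟨k, (w k).right ((v k).right i), (x + ((v k).left ((v k).right i)).toAdd) +
        ((w k).left ((w k).right ((v k).right i))).toAdd⟩ : CycModel m fun k => Fin (N k))
      simp only [Pi.mul_apply, SemidirectProduct.mul_left, SemidirectProduct.mul_right,
        Perm.mul_apply, toAdd_mul, permMulAut, MonoidHom.coe_mk, OneHom.coe_mk, MulEquiv.coe_mk,
        Equiv.coe_fn_mk, Perm.inv_def, Equiv.symm_apply_apply]
      refine congrArg (fun z => (⟨k, _, z⟩ : CycModel m fun k => Fin (N k))) ?_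
      rw [add_assoc]
      exact congrArg (x + ·) (add_comm _ _) }

theorem wreathToPerm_apply (m : ℕ) (N : Fin m → ℕ)
    (w : ∀ k : Fin m, Wreath (Multiplicative (ZMod ((k : ℕ) + 1))) (N k))
    (k : Fin m) (i : Fin (N k)) (x : ZMod ((k : ℕ) + 1)) :
    wreathToPerm m N w ⟨k, i, x⟩ =
      ⟨k, (w k).right i, x + ((w k).left ((w k).right i)).toAdd⟩ := rfl

theorem wreathToPerm_injective (m : ℕ) (N : Fin m → ℕ) : Injective (wreathToPerm m N) := by
  intro w v h
  funext k
  have key : ∀ i, (w k).right i = (v k).right i ∧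
      (w k).left ((w k).right i) = (v k).left ((v k).right i) := by
    intro i
    have h1 := congrArg (fun p : Perm _ => p ⟨k, i, 0⟩) h
    simp only [wreathToPerm_apply] at h1
    have h2 := sigma_ext' (Q := fun k => Fin (N k)) h1
    simp only [Prod.mk.injEq, zero_add] at h2
    exact ⟨h2.1, Multiplicative.toAdd.injective h2.2⟩
  have hr : (w k).right = (v k).right := Equiv.ext fun i => (key i).1
  refine SemidirectProduct.ext ?_ hr
  funext j
  have := (key ((w k).right⁻¹ j)).2
  rw [← hr] at this
  simpa using this

theorem wreathToPerm_range (m : ℕ) (N : Fin m → ℕ) :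
    (wreathToPerm m N).range = Subgroup.centralizer {cycShift m fun k => Fin (N k)} := by
  ext τ
  rw [Subgroup.mem_centralizer_singleton_iff]
  constructor
  · rintro ⟨w, rfl⟩
    ext1 ⟨k, i, x⟩
    simp [wreathToPerm_apply, cycShift]
    exact add_right_comm _ _ _
  · intro h
    set s := cycShift m fun k => Fin (N k) with hs
    have hpow : ∀ (n : ℕ) t, τ ((s ^ n) t) = (s ^ n) (τ t) := by
      intro n t
      have : Commute τ s := h
      exact congrArg (fun p : Perm _ => p t) (this.pow_right n).eq
    have hdvd : ∀ (n : ℕ) t, (s ^ n) t = t ↔ (t.1 : ℕ) + 1 ∣ n := by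
      rintro n ⟨k, i, x⟩
      rw [hs, cycShift_pow, ← ZMod.natCast_eq_zero_iff]
      constructor
      · intro h
        have := sigma_ext' (Q := fun k => Fin (N k)) h
        simpa using this
      · intro h
        rw [h, add_zero]
    have hfst : ∀ t, (τ t).1 = t.1 := by
      intro t
      have : ∀ n : ℕ, ((τ t).1 : ℕ) + 1 ∣ n ↔ (t.1 : ℕ) + 1 ∣ n := by
        intro n
        rw [← hdvd, ← hdvd, ← hpow, τ.injective.eq_iff]
      have := Nat.dvd_antisymm ((this _).2 dvd_rfl) ((this _).1 dvd_rfl)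
      exact Fin.ext (by simpa using this)
    have hex : ∀ (k : Fin m) (i : Fin (N k)), ∃ b : Fin (N k) × ZMod ((k : ℕ) + 1),
        τ ⟨k, i, 0⟩ = ⟨k, b⟩ := by
      intro k i
      have := hfst ⟨k, i, 0⟩
      generalize τ ⟨k, i, 0⟩ = u at this
      rcases u with ⟨l, b⟩
      cases this
      exact ⟨b, rfl⟩
    choose b hb using hex
    have hτ : ∀ (k : Fin m) (i : Fin (N k)) (x : ZMod ((k : ℕ) + 1)), τ ⟨k, i, x⟩ = ⟨k, (b k i).1, x + (b k i).2⟩ := by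
      intro k i x
      have h1 := hpow x.val ⟨k, i, 0⟩
      rw [hb, hs, cycShift_pow, cycShift_pow] at h1
      simpa [add_comm] using h1
    have hinj : ∀ k, Injective fun i => (b k i).1 := by
      intro k i j hij
      have hij' : (b k i).1 = (b k j).1 := hij
      have : τ ⟨k, i, -(b k i).2⟩ = τ ⟨k, j, -(b k j).2⟩ := by
        rw [hτ, hτ, hij']; simp
      have := sigma_ext' (Q := fun k => Fin (N k)) (τ.injective this)
      exact (Prod.mk.injEq _ _ _ _ ▸ this).1
    let π : ∀ k, Perm (Fin (N k)) := fun k =>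
      Equiv.ofBijective _ (Finite.injective_iff_bijective.1 (hinj k))
    refine ⟨fun k => ⟨fun j => Multiplicative.ofAdd (b k ((π k).symm j)).2, π k⟩, ?_⟩
    ext1 ⟨k, i, x⟩
    rw [wreathToPerm_apply, hτ]
    simp [π]

end Helpers

/-- The centralizer of a permutation `σ ∈ S_m` is isomorphic to the product
`∏_{k=1}^{m} ((ℤ/k) ≀ S_{N_k(σ)})`, where `N_k(σ)` is the number of cycles of
`σ` of length `k` (fixed points counted as cycles of length `1`). -/
theorem centralizer_of_perm_iso_prod_wreath (m : ℕ) (hm : 1 ≤ m) (σ : Equiv.Perm (Fin m)) :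
    Nonempty
      ((Subgroup.centralizer ({σ} : Set (Equiv.Perm (Fin m)))) ≃*
        ∀ k : Fin m, Wreath (Multiplicative (ZMod ((k : ℕ) + 1))) (cycleCount σ ((k : ℕ) + 1))) := by
  obtain ⟨e, he⟩ := exists_cycModel σ
  let N : Fin m → ℕ := fun k => cycleCount σ ((k : ℕ) + 1)
  have hconj : e.permCongrHom (cycShift m fun k => Fin (N k)) = σ := by
    ext1 a
    have := he (e.symm a)
    rw [Equiv.apply_symm_apply] at this
    exact this
  have hmap : (Subgroup.centralizer {cycShift m fun k => Fin (N k)}).map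
      e.permCongrHom.toMonoidHom = Subgroup.centralizer {σ} := by
    ext τ
    rw [Subgroup.mem_map_equiv, Subgroup.mem_centralizer_singleton_iff,
      Subgroup.mem_centralizer_singleton_iff,
      ← e.permCongrHom.injective.eq_iff, map_mul, map_mul, MulEquiv.apply_symm_apply, hconj]
  let e1 := MonoidHom.ofInjective (wreathToPerm_injective m N)
  let e2 := MulEquiv.subgroupCongr (wreathToPerm_range m N)
  let e3 := e.permCongrHom.subgroupMap (Subgroup.centralizer {cycShift m fun k => Fin (N k)})
  let e4 := MulEquiv.subgroupCongr hmap
  exact ⟨(((e1.trans e2).trans e3).trans e4).symm⟩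
end

section
/- Let G be a finite group and m ≥ 1. Two elements (h; σ) and (h'; σ') of the wreath product G ≀ S_m are conjugate if and only if for every k ≥ 1 and every conjugacy class c of G, the number of cycles of σ of length k whose cycle product lies in c equals the number of cycles of σ' of length k whose cycle product lies in c, i.e. m_{k,c}(h; σ) = m_{k,c}(h'; σ') for all k and c. -/
/-- The cycle product of `(h; σ)` along the cycle of `σ` through `a`: if the cycle
through `a` has length `k` (the minimal period of `a` under `σ`, so `k = 1` at a
fixed point), this is `h (σ^{k-1} a) * ⋯ * h (σ a) * h a`. -/
noncomputable def cycleProd {G : Type*} [Group G] {m : ℕ} (h : Fin m → G) (σ : Equiv.Perm (Fin m))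
    (a : Fin m) : G :=
  (((List.range (Function.minimalPeriod (⇑σ) a)).reverse).map fun i => h ((σ ^ i) a)).prod

/-- `mCount x k c` is the number of cycles of length `k` of the permutation part of
`x = (h; σ) ∈ G ≀ S_m` whose cycle product lies in the conjugacy class `c` of `G`:
the number of points lying on such cycles, divided by `k`. -/
noncomputable def mCount {G : Type*} [Group G] {m : ℕ} (x : Wreath G m) (k : ℕ)
    (c : ConjClasses G) : ℕ :=
  Nat.card {a : Fin m // Function.minimalPeriod (⇑x.right) a = k ∧
    ConjClasses.mk (cycleProd x.left x.right a) = c} / k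

namespace WreathAux

open Function

variable {G : Type*} [Group G] {m : ℕ}

/-- partial cycle products -/
def qp (h : Fin m → G) (σ : Equiv.Perm (Fin m)) : ℕ → Fin m → G
  | 0, _ => 1
  | n + 1, a => h ((σ ^ n) a) * qp h σ n a

theorem cycleProd_eq (h : Fin m → G) (σ : Equiv.Perm (Fin m)) (a : Fin m) :
    cycleProd h σ a = qp h σ (minimalPeriod σ a) a := by
  unfold cycleProd
  generalize minimalPeriod σ a = n
  induction n with
  | zero => simp [qp]
  | succ n ih => simp [qp, List.range_succ, ← ih]

theorem qp_add (h : Fin m → G) (σ : Equiv.Perm (Fin m)) (n k : ℕ) (a : Fin m) :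
    qp h σ (n + k) a = qp h σ n ((σ ^ k) a) * qp h σ k a := by
  induction n with
  | zero => simp [qp]
  | succ n ih =>
    rw [Nat.add_right_comm]
    simp only [qp, ih, mul_assoc, pow_add, Equiv.Perm.mul_apply]

theorem pow_minPer (σ : Equiv.Perm (Fin m)) (a : Fin m) :
    (σ ^ (minimalPeriod σ a)) a = a := by
  rw [← Equiv.Perm.iterate_eq_pow]
  exact isPeriodicPt_minimalPeriod σ a

theorem minPer_pos (σ : Equiv.Perm (Fin m)) (a : Fin m) : 0 < minimalPeriod σ a :=
  minimalPeriod_pos_of_mem_periodicPts (σ.injective.mem_periodicPts a)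

theorem pow_eq_iff (σ : Equiv.Perm (Fin m)) (a : Fin m) (n n' : ℕ) :
    (σ ^ n) a = (σ ^ n') a ↔ n ≡ n' [MOD minimalPeriod σ a] := by
  wlog hle : n ≤ n' generalizing n n'
  · rw [eq_comm, this n' n (by omega)]
    exact ⟨Nat.ModEq.symm, Nat.ModEq.symm⟩
  obtain ⟨d, rfl⟩ := Nat.exists_eq_add_of_le hle
  rw [Nat.modEq_iff_dvd' hle, Nat.add_sub_cancel_left, pow_add, Equiv.Perm.mul_apply,
    (σ ^ n).injective.eq_iff, ← isPeriodicPt_iff_minimalPeriod_dvd, IsPeriodicPt, IsFixedPt,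
    Equiv.Perm.iterate_eq_pow, eq_comm]

theorem minPer_pow (σ : Equiv.Perm (Fin m)) (a : Fin m) (n : ℕ) :
    minimalPeriod σ ((σ ^ n) a) = minimalPeriod σ a := by
  rw [← Equiv.Perm.iterate_eq_pow]
  exact minimalPeriod_apply_iterate (σ.injective.mem_periodicPts a) n

theorem mk_cycleProd_pow (h : Fin m → G) (σ : Equiv.Perm (Fin m)) (a : Fin m) (n : ℕ) :
    ConjClasses.mk (cycleProd h σ ((σ ^ n) a)) = ConjClasses.mk (cycleProd h σ a) := by
  rw [ConjClasses.mk_eq_mk_iff_isConj, isConj_comm, isConj_iff]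
  refine ⟨qp h σ n a, ?_⟩
  rw [cycleProd_eq, cycleProd_eq, minPer_pow, mul_inv_eq_iff_eq_mul, ← qp_add, add_comm, add_comm n,
    add_comm, qp_add]
  rw [pow_minPer]

/-- length and product class of the cycle through a point -/
noncomputable def key (h : Fin m → G) (σ : Equiv.Perm (Fin m)) (a : Fin m) :
    ℕ × ConjClasses G := (minimalPeriod σ a, ConjClasses.mk (cycleProd h σ a))

theorem key_pow (h : Fin m → G) (σ : Equiv.Perm (Fin m)) (a : Fin m) (n : ℕ) :
    key h σ ((σ ^ n) a) = key h σ a := by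
  simp [key, minPer_pow, mk_cycleProd_pow]

/-- the set of cycles -/
abbrev Cyc (σ : Equiv.Perm (Fin m)) := Quotient (Equiv.Perm.SameCycle.setoid σ)

/-- representative of a cycle -/
noncomputable def rep (σ : Equiv.Perm (Fin m)) (q : Cyc σ) : Fin m := Quotient.out q

theorem exists_rep (σ : Equiv.Perm (Fin m)) (a : Fin m) :
    ∃ p : Cyc σ × ℕ, (σ ^ p.2) (rep σ p.1) = a := by
  have h : Equiv.Perm.SameCycle σ (rep σ (Quotient.mk _ a)) a := Quotient.mk_out (s := Equiv.Perm.SameCycle.setoid σ) a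
  obtain ⟨n, hn⟩ := h.exists_nat_pow_eq
  exact ⟨⟨_, n⟩, hn⟩

theorem rep_inj (σ : Equiv.Perm (Fin m)) (q q' : Cyc σ) (n n' : ℕ)
    (h : (σ ^ n) (rep σ q) = (σ ^ n') (rep σ q')) : q = q' := by
  have : Equiv.Perm.SameCycle σ (rep σ q) (rep σ q') := by
    rw [← Equiv.Perm.sameCycle_pow_left (n := n), h, Equiv.Perm.sameCycle_pow_left]
  have h2 := Quotient.sound (s := Equiv.Perm.SameCycle.setoid σ) this
  simpa [rep] using h2

theorem card_cyc (h : Fin m → G) (σ : Equiv.Perm (Fin m)) (k : ℕ) (c : ConjClasses G) :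
    Nat.card {a // key h σ a = (k, c)} =
      Nat.card {q : Cyc σ // key h σ (rep σ q) = (k, c)} * k := by
  have : Nat.card ({q : Cyc σ // key h σ (rep σ q) = (k, c)} × Fin k) =
      Nat.card {a // key h σ a = (k, c)} := by
    refine Nat.card_eq_of_bijective
      (fun p => ⟨(σ ^ (p.2 : ℕ)) (rep σ p.1.1), by rw [key_pow]; exact p.1.2⟩) ⟨?_, ?_⟩
    · rintro ⟨⟨q, hq⟩, n⟩ ⟨⟨q', hq'⟩, n'⟩ he
      simp only [Subtype.mk.injEq] at he
      obtain rfl := rep_inj σ q q' _ _ he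
      rw [pow_eq_iff] at he
      have hk : minimalPeriod σ (rep σ q) = k := congrArg Prod.fst hq
      rw [hk] at he
      have := Nat.ModEq.eq_of_lt_of_lt he n.2 n'.2
      simp [Fin.ext_iff, this]
    · rintro ⟨a, ha⟩
      obtain ⟨⟨q, n⟩, rfl⟩ := exists_rep σ a
      dsimp only at ha
      rw [key_pow] at ha
      have hk : minimalPeriod σ (rep σ q) = k := congrArg Prod.fst ha
      have hpos := minPer_pos σ (rep σ q)
      rw [hk] at hpos
      refine ⟨⟨⟨q, ha⟩, ⟨n % k, Nat.mod_lt _ hpos⟩⟩, ?_⟩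
      simp only [Subtype.mk.injEq]
      rw [pow_eq_iff, hk]
      exact Nat.mod_modEq n k
  rw [← this, Nat.card_prod, Nat.card_fin]

theorem mCount_eq (x : Wreath G m) (k : ℕ) (c : ConjClasses G) :
    mCount x k c = Nat.card {a // key x.left x.right a = (k, c)} / k := by
  simp only [mCount, key, Prod.mk.injEq]

theorem mCount_eq' (x : Wreath G m) (k : ℕ) (hk : 1 ≤ k) (c : ConjClasses G) :
    mCount x k c = Nat.card {q : Cyc x.right // key x.left x.right (rep _ q) = (k, c)} := by
  rw [mCount_eq, card_cyc, Nat.mul_div_cancel _ hk]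

theorem isConj_iff_exists (x y : Wreath G m) : IsConj x y ↔
    ∃ (τ : Equiv.Perm (Fin m)) (w : Fin m → G), (∀ j, τ (x.right j) = y.right (τ j)) ∧
      ∀ j, w (x.right j) * x.left j = y.left (τ j) * w j := by
  rw [isConj_iff]
  constructor
  · rintro ⟨c, hc⟩
    rw [mul_inv_eq_iff_eq_mul] at hc
    have hr : ∀ j, c.right (x.right j) = y.right (c.right j) := fun j => by
      have := congrArg (fun z : Wreath G m => z.right j) hc
      simpa using this
    refine ⟨c.right, fun j => c.left (c.right (x.right⁻¹ j)), hr, fun j => ?_⟩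
    have := congrArg (fun z : Wreath G m => z.left (c.right j)) hc
    have h2 : y.right.symm (c.right j) = c.right (x.right.symm j) := by
      rw [Equiv.symm_apply_eq, ← hr]; simp
    simpa [permMulAut, h2] using this
  · rintro ⟨τ, w, hr, hw⟩
    refine ⟨⟨fun i => w (x.right (τ⁻¹ i)), τ⟩, ?_⟩
    rw [mul_inv_eq_iff_eq_mul]
    refine SemidirectProduct.ext ?_ ?_
    · funext i
      have h2 : τ⁻¹ (y.right⁻¹ i) = x.right⁻¹ (τ⁻¹ i) := by
        rw [Equiv.Perm.inv_eq_iff_eq, Equiv.Perm.inv_eq_iff_eq, ← hr]; simp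
      have := hw (τ⁻¹ i)
      change w (x.right (τ⁻¹ i)) * x.left (τ⁻¹ i) =
        y.left i * w (x.right (τ⁻¹ (y.right⁻¹ i)))
      rw [h2]
      simpa using this
    · ext j
      simp [hr]

theorem key_eq_of (x y : Wreath G m) (τ : Equiv.Perm (Fin m)) (w : Fin m → G)
    (hr : ∀ j, τ (x.right j) = y.right (τ j))
    (hw : ∀ j, w (x.right j) * x.left j = y.left (τ j) * w j) (a : Fin m) :
    key y.left y.right (τ a) = key x.left x.right a := by
  have hp : ∀ n a, τ ((x.right ^ n) a) = (y.right ^ n) (τ a) := by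
    intro n a
    induction n with
    | zero => simp
    | succ n ih => simp [pow_succ', hr, ih]
  have hq : ∀ n, w ((x.right ^ n) a) * qp x.left x.right n a = qp y.left y.right n (τ a) * w a := by
    intro n
    induction n with
    | zero => simp [qp]
    | succ n ih =>
      rw [qp, qp, mul_assoc, ← ih, ← hp, ← mul_assoc, ← mul_assoc, ← hw, pow_succ',
        Equiv.Perm.mul_apply]
  have hm : minimalPeriod y.right (τ a) = minimalPeriod x.right a := by
    apply Nat.dvd_antisymm
    · rw [← isPeriodicPt_iff_minimalPeriod_dvd, IsPeriodicPt, IsFixedPt,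
        Equiv.Perm.iterate_eq_pow, ← hp, pow_minPer]
    · rw [← isPeriodicPt_iff_minimalPeriod_dvd, IsPeriodicPt, IsFixedPt,
        Equiv.Perm.iterate_eq_pow]
      apply τ.injective
      rw [hp, pow_minPer]
  rw [key, key, hm, Prod.mk.injEq]
  refine ⟨rfl, ?_⟩
  rw [ConjClasses.mk_eq_mk_iff_isConj, isConj_comm, isConj_iff]
  refine ⟨w a, ?_⟩
  rw [mul_inv_eq_iff_eq_mul, cycleProd_eq, cycleProd_eq, hm, ← hq, pow_minPer]

theorem exists_equiv (x y : Wreath G m)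
    (h : ∀ k : ℕ, 1 ≤ k → ∀ c : ConjClasses G, mCount x k c = mCount y k c) :
    ∃ e : Cyc x.right ≃ Cyc y.right, ∀ q,
      key y.left y.right (rep _ (e q)) = key x.left x.right (rep _ q) := by
  have hc : ∀ p : ℕ × ConjClasses G,
      Nonempty ({q : Cyc x.right // key x.left x.right (rep _ q) = p} ≃
        {q : Cyc y.right // key y.left y.right (rep _ q) = p}) := by
    rintro ⟨k, c⟩
    rcases Nat.eq_zero_or_pos k with rfl | hk
    · have h1 : IsEmpty {q : Cyc x.right // key x.left x.right (rep _ q) = (0, c)} :=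
        ⟨fun q => (minPer_pos _ _).ne' (congrArg Prod.fst q.2)⟩
      have h2 : IsEmpty {q : Cyc y.right // key y.left y.right (rep _ q) = (0, c)} :=
        ⟨fun q => (minPer_pos _ _).ne' (congrArg Prod.fst q.2)⟩
      exact ⟨Equiv.equivOfIsEmpty _ _⟩
    · have := h k hk c
      rw [mCount_eq' _ _ hk, mCount_eq' _ _ hk] at this
      exact (Finite.card_eq).1 this
  refine ⟨Equiv.ofFiberEquiv (f := fun q => key x.left x.right (rep _ q))
    (g := fun q => key y.left y.right (rep _ q)) fun p => (hc p).some, fun q => ?_⟩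
  exact Equiv.ofFiberEquiv_map (f := fun q => key x.left x.right (rep _ q))
    (g := fun q => key y.left y.right (rep _ q)) (fun p => (hc p).some) q

theorem exists_conj (x y : Wreath G m) (e : Cyc x.right ≃ Cyc y.right)
    (he : ∀ q, key y.left y.right (rep _ (e q)) = key x.left x.right (rep _ q)) :
    ∃ (τ : Equiv.Perm (Fin m)) (w : Fin m → G), (∀ j, τ (x.right j) = y.right (τ j)) ∧
      ∀ j, w (x.right j) * x.left j = y.left (τ j) * w j := by
  choose p hp using exists_rep x.right
  have hper : ∀ q, minimalPeriod y.right (rep _ (e q)) = minimalPeriod x.right (rep _ q) :=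
    fun q => congrArg Prod.fst (he q)
  have hconj : ∀ q, ∃ g : G, g * cycleProd x.left x.right (rep _ q)
      = cycleProd y.left y.right (rep _ (e q)) * g := by
    intro q
    have := congrArg Prod.snd (he q)
    simp only [key] at this
    rw [ConjClasses.mk_eq_mk_iff_isConj, isConj_comm, isConj_iff] at this
    obtain ⟨g, hg⟩ := this
    exact ⟨g, mul_inv_eq_iff_eq_mul.1 hg⟩
  choose g hg using hconj
  let R : Cyc x.right → ℕ → G := fun q n =>
    qp y.left y.right n (rep _ (e q)) * g q * (qp x.left x.right n (rep _ q))⁻¹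
  have hR : ∀ q, Function.Periodic (R q) (minimalPeriod x.right (rep _ q)) := by
    intro q n
    have h1 := pow_minPer y.right (rep _ (e q))
    have h2 := hg q
    rw [cycleProd_eq, cycleProd_eq] at h2
    rw [hper] at h1 h2
    simp only [R]
    rw [qp_add, qp_add, h1, pow_minPer, mul_assoc (qp y.left y.right n _), ← h2]
    group
  let T : Fin m → Fin m := fun j => (y.right ^ (p j).2) (rep _ (e (p j).1))
  let w : Fin m → G := fun j => R (p j).1 (p j).2
  have key1 : ∀ q n, (p ((x.right ^ n) (rep _ q))).1 = q ∧
      (p ((x.right ^ n) (rep _ q))).2 ≡ n [MOD minimalPeriod x.right (rep _ q)] := by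
    intro q n
    have h1 := hp ((x.right ^ n) (rep _ q))
    have h2 := rep_inj _ _ _ _ _ h1
    rw [h2] at h1
    exact ⟨h2, (pow_eq_iff _ _ _ _).1 h1⟩
  have hT : ∀ q n, T ((x.right ^ n) (rep _ q)) = (y.right ^ n) (rep _ (e q)) := by
    intro q n
    obtain ⟨h1, h2⟩ := key1 q n
    simp only [T]
    rw [h1, pow_eq_iff, hper]
    exact h2
  have hw : ∀ q n, w ((x.right ^ n) (rep _ q)) = R q n := by
    intro q n
    obtain ⟨h1, h2⟩ := key1 q n
    simp only [w]
    rw [h1, ← (hR q).map_mod_nat, h2, (hR q).map_mod_nat]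
  have hinj : Function.Injective T := by
    intro i j hij
    obtain ⟨⟨q, n⟩, rfl⟩ := exists_rep x.right i
    obtain ⟨⟨q', n'⟩, rfl⟩ := exists_rep x.right j
    simp only [hT] at hij ⊢
    have := e.injective (rep_inj _ _ _ _ _ hij)
    subst this
    rw [pow_eq_iff, hper] at hij
    rwa [pow_eq_iff]
  refine ⟨Equiv.ofBijective T (Finite.injective_iff_bijective.1 hinj), w, fun j => ?_, fun j => ?_⟩
  · obtain ⟨⟨q, n⟩, rfl⟩ := exists_rep x.right j
    simp only [Equiv.ofBijective_apply]
    rw [← Equiv.Perm.mul_apply, ← pow_succ', hT, hT, pow_succ', Equiv.Perm.mul_apply]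
  · obtain ⟨⟨q, n⟩, rfl⟩ := exists_rep x.right j
    simp only [Equiv.ofBijective_apply]
    rw [← Equiv.Perm.mul_apply, ← pow_succ', hT, hw, hw]
    simp only [R, qp]
    group

end WreathAux

/-- Two elements of the wreath product `G ≀ S_m` (for `G` a finite group) are conjugate
if and only if, for every `k ≥ 1` and every conjugacy class `c` of `G`, they have the
same number of cycles of length `k` with cycle product in `c`. -/
theorem isConj_wreath_iff_mCount_eq (G : Type*) [Group G] [Finite G] (m : ℕ) (hm : 1 ≤ m)
    (x y : Wreath G m) :
    IsConj x y ↔ ∀ k : ℕ, 1 ≤ k → ∀ c : ConjClasses G, mCount x k c = mCount y k c := by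
  rw [WreathAux.isConj_iff_exists]
  constructor
  · rintro ⟨τ, w, hr, hw⟩ k _ c
    rw [WreathAux.mCount_eq, WreathAux.mCount_eq]
    congr 1
    exact Nat.card_congr (τ.subtypeEquiv fun a => by rw [WreathAux.key_eq_of x y τ w hr hw a])
  · intro h
    obtain ⟨e, he⟩ := WreathAux.exists_equiv x y h
    exact WreathAux.exists_conj x y e he
end

section
/- Let G be a finite group and m ≥ 1. For (h; σ) ∈ G ≀ S_m, the order of the centralizer of (h; σ) in G ≀ S_m equals ∏_{k=1}^{m} ∏_{c ∈ ConjClasses(G)} (k · |C_G(x_c)|)^{m_{k,c}(h;σ)} · (m_{k,c}(h;σ))!, where x_c is any representative of the conjugacy class c and C_G(x_c) is its centralizer in G. -/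
open Equiv

theorem abs_bij {H Ω Q I : Type*} [Group H] [Finite Ω] (φ : H →* Perm Ω)
    (r : Ω → Q) (b : Q → Ω) (hb : ∀ q, r (b q) = q)
    (hr : ∀ p p', r p = r p' ↔ ∃ h, φ h p = p') (inv : Ω → I)
    (hinv : ∀ p p', inv p = inv p' ↔ ∀ h, φ h p = p ↔ φ h p' = p') :
    Nat.card {e : Perm Ω // ∀ h p, e (φ h p) = φ h (e p)} =
    Nat.card {u : Q → Ω // Function.Bijective (r ∘ u) ∧ ∀ q, inv (u q) = inv (b q)} := by
  have hrr : ∀ p, ∃ h, φ h (b (r p)) = p := fun p => (hr _ _).1 (hb _)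
  have key : ∀ e : Perm Ω, (∀ h p, e (φ h p) = φ h (e p)) → ∀ p p', r (e p) = r (e p') ↔ r p = r p' := by
    intro e he p p'
    rw [hr, hr]
    constructor
    · rintro ⟨h, hh⟩
      exact ⟨h, e.injective (by rw [he, hh])⟩
    · rintro ⟨h, hh⟩
      exact ⟨h, by rw [← he, hh]⟩
  refine Nat.card_eq_of_bijective (fun e => ⟨fun q => e.1 (b q), ⟨?_, ?_⟩, ?_⟩) ⟨?_, ?_⟩
  · intro q q' hq
    have := (key e.1 e.2 _ _).1 hq
    rwa [hb, hb] at this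
  · intro q
    refine ⟨r (e.1.symm (b q)), ?_⟩
    have := (key e.1 e.2 (b (r (e.1.symm (b q)))) (e.1.symm (b q))).2 (hb _)
    simpa [hb] using this
  · intro q
    rw [hinv]
    intro h
    rw [← e.2]
    exact e.1.injective.eq_iff
  · rintro ⟨e, he⟩ ⟨e', he'⟩ h
    have h : ∀ q, e (b q) = e' (b q) := fun q => congrFun (congrArg Subtype.val h) q
    ext p
    obtain ⟨h', hh⟩ := hrr p
    simp only
    rw [← hh, he, he', h]
  · rintro ⟨u, hu, hi⟩
    choose s hs using hrr
    have wd : ∀ h q, φ (s (φ h (b q))) (u q) = φ h (u q) := by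
      intro h q
      have h1 : r (φ h (b q)) = q := by
        rw [← (hr (b q) _).2 ⟨h, rfl⟩, hb]
      have h2 := hs (φ h (b q))
      rw [h1] at h2
      have h3 : φ (h⁻¹ * s (φ h (b q))) (b q) = b q := by
        rw [map_mul, Perm.mul_apply, h2, map_inv]; simp
      have h4 := ((hinv _ _).1 (hi q) _).2 h3
      rw [map_mul, Perm.mul_apply, map_inv, Perm.inv_eq_iff_eq] at h4
      exact h4
    let E : Ω → Ω := fun p => φ (s p) (u (r p))
    have hE : ∀ h q, E (φ h (b q)) = φ h (u q) := by
      intro h q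
      have h1 : r (φ h (b q)) = q := by
        rw [← (hr (b q) _).2 ⟨h, rfl⟩, hb]
      simp only [E, h1, wd]
    have hsurj : Function.Surjective E := by
      intro p
      obtain ⟨q, hq⟩ := hu.2 (r p)
      obtain ⟨h, hh⟩ := (hr _ _).1 hq
      exact ⟨φ h (b q), by rw [hE, hh]⟩
    refine ⟨⟨Equiv.ofBijective E (Finite.surjective_iff_bijective.1 hsurj), ?_⟩, ?_⟩
    · intro h p
      simp only [Equiv.ofBijective_apply]
      conv_lhs => rw [← hs p]
      rw [← Perm.mul_apply, ← map_mul, hE, map_mul]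
      rfl
    · ext q
      simp only [Equiv.ofBijective_apply]
      have := hE 1 q
      simpa using this

theorem abs_count {H Ω Q I T : Type*} [Group H] [Finite Ω] [Fintype Q] [DecidableEq T]
    (φ : H →* Perm Ω)
    (r : Ω → Q) (b : Q → Ω) (hb : ∀ q, r (b q) = q)
    (hr : ∀ p p', r p = r p' ↔ ∃ h, φ h p = p') (inv : Ω → I)
    (hinv : ∀ p p', inv p = inv p' ↔ ∀ h, φ h p = p ↔ φ h p' = p')
    (typ : Q → T) (w : T → ℕ)
    (hw : ∀ q q', Nat.card {p // r p = q' ∧ inv p = inv (b q)} =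
      if typ q' = typ q then w (typ q) else 0) :
    Nat.card {e : Perm Ω // ∀ h p, e (φ h p) = φ h (e p)} =
      ∏ t ∈ Finset.univ.image typ, w t ^ (Nat.card {q // typ q = t}) *
        (Nat.card {q // typ q = t}).factorial := by
  classical
  rw [abs_bij φ r b hb hr inv hinv]
  let U := {u : Q → Ω // Function.Bijective (r ∘ u) ∧ ∀ q, inv (u q) = inv (b q)}
  let f : U → Perm Q := fun u => Equiv.ofBijective _ u.2.1
  have h1 : Nat.card U = ∑ π : Perm Q, Nat.card {u : U // f u = π} := by
    rw [← Nat.card_sigma]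
    exact Nat.card_congr (Equiv.sigmaFiberEquiv f).symm
  have h2 : ∀ π : Perm Q, Nat.card {u : U // f u = π} =
      ∏ q, Nat.card {p // r p = π q ∧ inv p = inv (b q)} := by
    intro π
    rw [← Nat.card_pi]
    refine Nat.card_congr ⟨fun u q => ⟨u.1.1 q, ?_, u.1.2.2 q⟩, fun v => ⟨⟨fun q => (v q).1, ?_, fun q => (v q).2.2⟩, ?_⟩, fun _ => rfl, fun _ => rfl⟩
    · exact congrArg (fun e : Perm Q => e q) u.2
    · have : (r ∘ fun q => (v q).1) = π := by
        ext q; exact (v q).2.1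
      rw [this]; exact π.bijective
    · ext q; exact (v q).2.1
  change Nat.card U = _
  rw [h1]
  simp_rw [h2, hw]
  have h3 : ∀ π : Perm Q, (∏ q, if typ (π q) = typ q then w (typ q) else 0) =
      if typ ∘ π = typ then ∏ q, w (typ q) else 0 := by
    intro π
    split_ifs with h
    · refine Finset.prod_congr rfl fun q _ => if_pos (congrFun h q)
    · obtain ⟨q, hq⟩ : ∃ q, typ (π q) ≠ typ q := by
        by_contra! hc
        exact h (funext hc)
      exact Finset.prod_eq_zero (Finset.mem_univ q) (if_neg hq)
  simp_rw [h3]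
  rw [← Finset.sum_filter, Finset.sum_const, smul_eq_mul, ← Fintype.card_subtype,
    DomMulAct.stabilizer_card', Finset.prod_mul_distrib, mul_comm]
  congr 1
  · rw [← Finset.prod_fiberwise_of_maps_to (g := typ) (t := Finset.univ.image typ) (by simp)]
    refine Finset.prod_congr rfl fun t _ => ?_
    rw [Finset.prod_congr rfl (g := fun _ => w t) (by simp +contextual), Finset.prod_const, Nat.card_eq_fintype_card, Fintype.card_subtype]
  · refine Finset.prod_congr rfl fun t _ => ?_
    rw [Nat.card_eq_fintype_card]

section wr
variable {G : Type*} [Group G] {m : ℕ}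

def wAct : Wreath G m →* Perm (Fin m × G) where
  toFun y :=
    { toFun := fun p => (y.right p.1, y.left (y.right p.1) * p.2)
      invFun := fun p => (y.right⁻¹ p.1, (y.left p.1)⁻¹ * p.2)
      left_inv := fun p => by simp
      right_inv := fun p => by simp }
  map_one' := by ext p <;> simp
  map_mul' := fun y z => by
    ext p
    · simp
    · simp [permMulAut, mul_assoc]

theorem wAct_apply (y : Wreath G m) (p : Fin m × G) :
    wAct y p = (y.right p.1, y.left (y.right p.1) * p.2) := rfl

def rAct : G →* Perm (Fin m × G) where
  toFun γ :=
    { toFun := fun p => (p.1, p.2 * γ⁻¹)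
      invFun := fun p => (p.1, p.2 * γ)
      left_inv := fun p => by simp
      right_inv := fun p => by simp }
  map_one' := by ext p <;> simp
  map_mul' := fun y z => by ext p <;> simp [mul_assoc]

theorem rAct_apply (γ : G) (p : Fin m × G) : rAct γ p = (p.1, p.2 * γ⁻¹) := rfl

theorem wr_comm (y : Wreath G m) (γ : G) : Commute (wAct y) (rAct γ) := by
  ext p <;> simp [wAct_apply, rAct_apply, mul_assoc]

def bigAct (x : Wreath G m) : Multiplicative ℤ × G →* Perm (Fin m × G) :=
  MonoidHom.noncommCoprod (zpowersHom _ (wAct x)) rAct (fun n γ => by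
    simpa using (wr_comm x γ).zpow_left _)

theorem bigAct_apply (x : Wreath G m) (n : Multiplicative ℤ) (γ : G) (p : Fin m × G) :
    bigAct x (n, γ) p = (wAct x ^ n.toAdd) (rAct γ p) := rfl

theorem card_cent (x : Wreath G m) :
    Nat.card (Subgroup.centralizer ({x} : Set (Wreath G m))) =
    Nat.card {e : Perm (Fin m × G) // ∀ h p, e (bigAct x h p) = bigAct x h (e p)} := by
  refine Nat.card_eq_of_bijective (fun y => ⟨wAct y.1, ?_⟩) ⟨?_, ?_⟩
  · rintro ⟨n, γ⟩ p
    have h1 : Commute y.1 x := (Subgroup.mem_centralizer_singleton_iff.1 y.2)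
    have h2 : Commute (wAct y.1) (wAct x ^ n.toAdd * rAct γ) :=
      ((h1.map wAct).zpow_right _).mul_right (wr_comm _ _)
    exact congrArg (fun e : Perm (Fin m × G) => e p) h2.eq
  · rintro ⟨y, hy⟩ ⟨z, hz⟩ h
    have h : ∀ p, wAct y p = wAct z p := fun p =>
      congrArg (fun e : Perm (Fin m × G) => e p) (congrArg Subtype.val h)
    have hr : y.right = z.right := by
      ext j
      have := congrArg Prod.fst (h (j, 1))
      exact congrArg _ this
    apply Subtype.ext
    refine SemidirectProduct.ext ?_ hr
    funext i
    have := congrArg Prod.snd (h (y.right⁻¹ i, 1))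
    simp only [wAct_apply, ← hr] at this
    simpa using this
  · rintro ⟨e, he⟩
    have heR : ∀ γ p, e (rAct γ p) = rAct γ (e p) := fun γ p => by
      simpa [bigAct_apply] using he (1, γ) p
    have heX : ∀ p, e (wAct x p) = wAct x (e p) := fun p => by
      simpa [bigAct_apply] using he (Multiplicative.ofAdd 1, 1) p
    have hsR : ∀ γ p, e.symm (rAct γ p) = rAct γ (e.symm p) := fun γ p => by
      rw [Equiv.symm_apply_eq, heR, Equiv.apply_symm_apply]
    have h1 : ∀ j g, e (j, g) = ((e (j, 1)).1, (e (j, 1)).2 * g) := by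
      intro j g
      have := heR g⁻¹ (j, 1)
      simpa only [rAct_apply, inv_inv, one_mul] using this
    have h2 : ∀ j g, e.symm (j, g) = ((e.symm (j, 1)).1, (e.symm (j, 1)).2 * g) := by
      intro j g
      have := hsR g⁻¹ (j, 1)
      simpa only [rAct_apply, inv_inv, one_mul] using this
    let τ : Perm (Fin m) :=
      { toFun := fun j => (e (j, 1)).1
        invFun := fun j => (e.symm (j, 1)).1
        left_inv := fun j => by
          have := h2 (e (j, 1)).1 (e (j, 1)).2
          simp only [Prod.mk.eta, Equiv.symm_apply_apply] at this
          exact (congrArg Prod.fst this).symm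
        right_inv := fun j => by
          have := h1 (e.symm (j, 1)).1 (e.symm (j, 1)).2
          simp only [Prod.mk.eta, Equiv.apply_symm_apply] at this
          exact (congrArg Prod.fst this).symm }
    let y : Wreath G m := ⟨fun i => (e (τ.symm i, 1)).2, τ⟩
    have hy : wAct y = e := by
      ext p : 1
      obtain ⟨j, g⟩ := p
      rw [h1, wAct_apply]
      simp only [y, Equiv.symm_apply_apply]
      rfl
    have hinj : Function.Injective (wAct : Wreath G m → _) := by
      intro y z h
      have h : ∀ p, wAct y p = wAct z p := fun p =>
        congrArg (fun e : Perm (Fin m × G) => e p) h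
      have hr : y.right = z.right := by
        ext j
        have := congrArg Prod.fst (h (j, 1))
        exact congrArg _ this
      refine SemidirectProduct.ext ?_ hr
      funext i
      have := congrArg Prod.snd (h (y.right⁻¹ i, 1))
      simp only [wAct_apply, ← hr] at this
      simpa using this
    refine ⟨⟨y, Subgroup.mem_centralizer_singleton_iff.2 (hinj ?_)⟩, Subtype.ext hy⟩
    rw [map_mul, map_mul, hy]
    ext p : 1
    exact heX p

/-- partial cycle products -/
def pp (h : Fin m → G) (σ : Perm (Fin m)) (n : ℕ) (a : Fin m) : G :=
  (((List.range n).reverse).map fun i => h ((σ ^ i) a)).prod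

theorem pp_succ (h : Fin m → G) (σ : Perm (Fin m)) (n : ℕ) (a : Fin m) :
    pp h σ (n + 1) a = h ((σ ^ n) a) * pp h σ n a := by
  simp [pp, List.range_succ]

theorem pp_succ' (h : Fin m → G) (σ : Perm (Fin m)) (n : ℕ) (a : Fin m) :
    pp h σ (n + 1) a = pp h σ n (σ a) * h a := by
  induction n with
  | zero => simp [pp]
  | succ n ih =>
    rw [pp_succ, ih, pp_succ h σ n (σ a), pow_succ, Perm.mul_apply, mul_assoc]

theorem wAct_pow (x : Wreath G m) (n : ℕ) (j : Fin m) (g : G) :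
    (wAct x ^ n) (j, g) = ((x.right ^ n) j, pp x.left x.right n (x.right j) * g) := by
  induction n with
  | zero => simp [pp]
  | succ n ih =>
    rw [pow_succ', Perm.mul_apply, ih, wAct_apply, pp_succ, pow_succ' x.right n, Perm.mul_apply]
    simp only [← Perm.mul_apply, ← pow_succ, ← pow_succ', mul_assoc]

theorem wAct_zpow_fst (x : Wreath G m) (n : ℤ) (p : Fin m × G) :
    ((wAct x ^ n) p).1 = (x.right ^ n) p.1 := by
  rw [← map_zpow, wAct_apply]
  have : (x ^ n).right = x.right ^ n := map_zpow SemidirectProduct.rightHom x n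
  rw [this]

theorem per_pos (σ : Perm (Fin m)) (j : Fin m) : 0 < Function.minimalPeriod σ j :=
  Function.minimalPeriod_pos_of_mem_periodicPts
    (Function.Injective.mem_periodicPts σ.injective j)

theorem per_apply (σ : Perm (Fin m)) (j : Fin m) :
    Function.minimalPeriod σ (σ j) = Function.minimalPeriod σ j :=
  Function.minimalPeriod_apply (Function.Injective.mem_periodicPts σ.injective j)

theorem per_dvd (σ : Perm (Fin m)) (j : Fin m) (n : ℤ) :
    (σ ^ n) j = j ↔ (Function.minimalPeriod σ j : ℤ) ∣ n :=
  MulAction.zpow_smul_eq_iff_minimalPeriod_dvd (a := σ) (b := j)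

theorem per_pow (σ : Perm (Fin m)) (j : Fin m) :
    (σ ^ (Function.minimalPeriod σ j)) j = j := by
  have := (per_dvd σ j _).2 dvd_rfl
  simpa using this

theorem cycleProd_conj (h : Fin m → G) (σ : Perm (Fin m)) (j : Fin m) :
    ConjClasses.mk (cycleProd h σ (σ j)) = ConjClasses.mk (cycleProd h σ j) := by
  have e1 : cycleProd h σ (σ j) = pp h σ (Function.minimalPeriod σ j) (σ j) := by
    rw [← per_apply]; rfl
  have e2 : cycleProd h σ j = pp h σ (Function.minimalPeriod σ j) j := rfl
  rw [ConjClasses.mk_eq_mk_iff_isConj, isConj_comm, isConj_iff]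
  refine ⟨h j, ?_⟩
  rw [e1, e2, mul_inv_eq_iff_eq_mul, ← pp_succ', pp_succ, per_pow]

/-- the type of a point -/
noncomputable def ptTyp (x : Wreath G m) (j : Fin m) : ℕ × ConjClasses G :=
  (Function.minimalPeriod x.right j, ConjClasses.mk (cycleProd x.left x.right j))

theorem ptTyp_apply (x : Wreath G m) (j : Fin m) : ptTyp x (x.right j) = ptTyp x j := by
  rw [ptTyp, per_apply, cycleProd_conj]; rfl

theorem ptTyp_same (x : Wreath G m) (i j : Fin m) (h : x.right.SameCycle i j) :
    ptTyp x i = ptTyp x j := by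
  obtain ⟨n, rfl⟩ := h.exists_nat_pow_eq
  clear h
  induction n with
  | zero => simp
  | succ n ih => rw [pow_succ', Perm.mul_apply, ptTyp_apply, ih]

noncomputable def ptInv (x : Wreath G m) (p : Fin m × G) : ℕ × G :=
  (Function.minimalPeriod x.right p.1, p.2⁻¹ * cycleProd x.left x.right (x.right p.1) * p.2)

theorem wAct_per (x : Wreath G m) (p : Fin m × G) :
    (wAct x ^ (ptInv x p).1) p = rAct (ptInv x p).2⁻¹ p := by
  obtain ⟨j, g⟩ := p
  have e1 : cycleProd x.left x.right (x.right j) =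
      pp x.left x.right (Function.minimalPeriod x.right j) (x.right j) := by
    rw [← per_apply]; rfl
  rw [wAct_pow, rAct_apply, ptInv, e1]
  simp [per_pow, mul_assoc]

theorem wAct_per_zpow (x : Wreath G m) (p : Fin m × G) (l : ℤ) :
    (wAct x ^ ((ptInv x p).1 * l : ℤ)) p = rAct ((ptInv x p).2 ^ l)⁻¹ p := by
  have h0 : (rAct (m := m) (ptInv x p).2 * wAct x ^ (ptInv x p).1) p = p := by
    rw [Perm.mul_apply, wAct_per, ← Perm.mul_apply, ← map_mul]; simp
  have hc : Commute (rAct (ptInv x p).2) (wAct x ^ (ptInv x p).1) :=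
    ((wr_comm x _).pow_left _).symm
  have h1 : ((rAct (m := m) (ptInv x p).2 * wAct x ^ (ptInv x p).1) ^ l) p = p :=
    Equiv.Perm.zpow_apply_eq_self_of_apply_eq_self h0 l
  rw [hc.mul_zpow, Perm.mul_apply, ← zpow_natCast, ← zpow_mul, ← map_zpow] at h1
  rw [map_inv, Perm.eq_inv_iff_eq]
  exact h1

theorem stab_iff (x : Wreath G m) (p : Fin m × G) (n : Multiplicative ℤ) (γ : G) :
    bigAct x (n, γ) p = p ↔ ∃ l : ℤ, n.toAdd = (ptInv x p).1 * l ∧ γ = (ptInv x p).2 ^ l := by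
  have hc : bigAct x (n, γ) p = rAct γ ((wAct x ^ n.toAdd) p) := by
    rw [bigAct_apply, ← Perm.mul_apply, ← Perm.mul_apply, ((wr_comm x γ).zpow_left _).eq]
  rw [hc]
  have h3 : ∀ l : ℤ, n.toAdd = (ptInv x p).1 * l →
      (rAct γ ((wAct x ^ n.toAdd) p) = p ↔ γ = (ptInv x p).2 ^ l) := by
    intro l hl
    rw [hl, wAct_per_zpow, rAct_apply, rAct_apply]
    obtain ⟨j, g⟩ := p
    simp only [inv_inv, mul_assoc, Prod.mk.injEq, true_and, mul_eq_left, mul_inv_eq_one]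
    exact eq_comm
  constructor
  · intro h
    have h1 := congrArg Prod.fst h
    rw [rAct_apply] at h1
    simp only [wAct_zpow_fst, per_dvd] at h1
    obtain ⟨l, hl⟩ := h1
    exact ⟨l, hl, (h3 l hl).1 h⟩
  · rintro ⟨l, hl, h⟩
    exact (h3 l hl).2 h

theorem ptInv_iff (x : Wreath G m) (p p' : Fin m × G) :
    ptInv x p = ptInv x p' ↔ ∀ h, bigAct x h p = p ↔ bigAct x h p' = p' := by
  constructor
  · rintro h ⟨n, γ⟩
    rw [stab_iff, stab_iff, h]
  · intro h
    have h1 := (h (Multiplicative.ofAdd ((ptInv x p).1 : ℤ), (ptInv x p).2))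
    have h2 := (h (Multiplicative.ofAdd ((ptInv x p').1 : ℤ), (ptInv x p').2))
    rw [stab_iff, stab_iff] at h1 h2
    obtain ⟨l, hl, hl'⟩ := h1.1 ⟨1, by simp⟩
    obtain ⟨l2, hl2, _⟩ := h2.2 ⟨1, by simp⟩
    simp only [toAdd_ofAdd] at hl hl2
    have hk : (ptInv x p).1 = (ptInv x p').1 :=
      Nat.dvd_antisymm (Int.natCast_dvd_natCast.1 ⟨_, hl2⟩) (Int.natCast_dvd_natCast.1 ⟨_, hl⟩)
    have hpos : ((ptInv x p').1 : ℤ) ≠ 0 := by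
      have := per_pos x.right p'.1
      exact_mod_cast this.ne'
    have : l = 1 := by
      rw [hk] at hl
      exact mul_left_cancel₀ hpos (by rw [← hl, mul_one])
    rw [this, zpow_one] at hl'
    exact Prod.ext hk hl'

theorem orb_iff (x : Wreath G m) (p p' : Fin m × G) :
    x.right.SameCycle p.1 p'.1 ↔ ∃ h, bigAct x h p = p' := by
  constructor
  · rintro ⟨n, hn⟩
    refine ⟨(Multiplicative.ofAdd n, p'.2⁻¹ * ((wAct x ^ n) p).2), ?_⟩
    rw [bigAct_apply, ← Perm.mul_apply, ((wr_comm x _).zpow_left _).eq, Perm.mul_apply, rAct_apply]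
    refine Prod.ext ?_ ?_
    · simp [wAct_zpow_fst, hn]
    · simp
  · rintro ⟨⟨n, γ⟩, rfl⟩
    refine ⟨n.toAdd, ?_⟩
    rw [bigAct_apply, wAct_zpow_fst]; rfl

theorem card_conj [Finite G] (D d : G) (h : IsConj D d) :
    Nat.card {g : G // g⁻¹ * D * g = d} =
      Nat.card (Subgroup.centralizer ({Quotient.out (ConjClasses.mk d)} : Set G)) := by
  obtain ⟨z, hz, hzd⟩ : ∃ z, z = Quotient.out (ConjClasses.mk d) ∧ IsConj z d := by
    refine ⟨_, rfl, ?_⟩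
    rw [← ConjClasses.mk_eq_mk_iff_isConj]
    exact Quotient.out_eq (ConjClasses.mk d)
  rw [← hz]
  clear hz
  obtain ⟨b, hb⟩ := isConj_iff.1 hzd
  obtain ⟨a, ha⟩ := isConj_iff.1 (h.trans hzd.symm)
  subst hb
  have hD : D = a⁻¹ * z * a := by rw [← ha]; group
  subst hD
  refine Nat.card_congr ⟨fun g => ⟨a * g.1 * b, ?_⟩, fun y => ⟨a⁻¹ * y.1 * b⁻¹, ?_⟩, ?_, ?_⟩
  · rw [Subgroup.mem_centralizer_singleton_iff]
    have := g.2
    have e : z = b⁻¹ * (b * z * b⁻¹) * b := by group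
    calc a * g.1 * b * z = a * g.1 * (b * z * b⁻¹) * b := by group
      _ = a * g.1 * (g.1⁻¹ * (a⁻¹ * z * a) * g.1) * b := by rw [this]
      _ = z * (a * g.1 * b) := by group
  · have := Subgroup.mem_centralizer_singleton_iff.1 y.2
    calc (a⁻¹ * y.1 * b⁻¹)⁻¹ * (a⁻¹ * z * a) * (a⁻¹ * y.1 * b⁻¹)
        = b * y.1⁻¹ * (z * y.1) * b⁻¹ := by group
      _ = b * y.1⁻¹ * (y.1 * z) * b⁻¹ := by rw [this]
      _ = b * z * b⁻¹ := by group
  · intro g; ext; simp [mul_assoc]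
  · intro g; ext; simp [mul_assoc]

theorem card_cyc (σ : Perm (Fin m)) (a : Fin m) :
    Nat.card {j // σ.SameCycle j a} = Function.minimalPeriod σ a := by
  classical
  have := MulAction.minimalPeriod_eq_card (a := σ) (b := a)
  change Function.minimalPeriod σ a = _ at this
  rw [this, ← Nat.card_eq_fintype_card]
  refine Nat.card_congr (Equiv.subtypeEquivRight fun j => ?_)
  rw [Equiv.Perm.sameCycle_comm]
  constructor
  · rintro ⟨n, rfl⟩
    exact ⟨⟨σ ^ n, n, rfl⟩, rfl⟩
  · rintro ⟨⟨_, n, rfl⟩, rfl⟩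
    exact ⟨n, rfl⟩

theorem card_fib [Finite G] (x : Wreath G m) (a : Fin m) (p : Fin m × G)  [DecidableEq (ℕ × ConjClasses G)] :
    Nat.card {p' : Fin m × G // x.right.SameCycle p'.1 a ∧ ptInv x p' = ptInv x p} =
      if ptTyp x a = ptTyp x p.1 then (ptTyp x p.1).1 *
        Nat.card (Subgroup.centralizer ({Quotient.out (ptTyp x p.1).2} : Set G)) else 0 := by
  have hmk : ∀ p : Fin m × G, ((ptInv x p).1, ConjClasses.mk (ptInv x p).2) = ptTyp x p.1 := by
    intro p
    rw [← ptTyp_apply]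
    refine Prod.ext (per_apply _ _).symm ?_
    simp only [ptTyp]
    rw [ConjClasses.mk_eq_mk_iff_isConj, isConj_iff]
    exact ⟨p.2, by simp [ptInv, mul_assoc]⟩
  split_ifs with h
  · have e : {p' : Fin m × G // x.right.SameCycle p'.1 a ∧ ptInv x p' = ptInv x p} ≃
      Σ j : {j // x.right.SameCycle j a},
        {g : G // g⁻¹ * cycleProd x.left x.right (x.right j.1) * g = (ptInv x p).2} :=
      { toFun := fun p' => ⟨⟨p'.1.1, p'.2.1⟩, ⟨p'.1.2, congrArg Prod.snd p'.2.2⟩⟩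
        invFun := fun s => ⟨(s.1.1, s.2.1), s.1.2, Prod.ext (by
          have h1 := ptTyp_same x _ _ s.1.2
          have h2 : (ptTyp x s.1.1).1 = (ptTyp x p.1).1 := congrArg Prod.fst (h1.trans h)
          exact h2) s.2.2⟩
        left_inv := fun _ => rfl
        right_inv := fun _ => rfl }
    classical
    rw [Nat.card_congr e, Nat.card_sigma]
    rw [Finset.sum_congr rfl (g := fun _ =>
      Nat.card (Subgroup.centralizer ({Quotient.out (ptTyp x p.1).2} : Set G)))]
    · rw [Finset.sum_const, smul_eq_mul, Finset.card_univ, ← Nat.card_eq_fintype_card, card_cyc, ← h]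
      rfl
    · rintro ⟨j, hj⟩ _
      rw [card_conj, ← hmk]
      rw [← ConjClasses.mk_eq_mk_iff_isConj]
      have h1 := (ptTyp_apply x j).trans ((ptTyp_same x _ _ hj).trans (h.trans (hmk p).symm))
      exact congrArg Prod.snd h1
  · rw [Nat.card_eq_zero]
    left
    refine ⟨fun ⟨p', h1, h2⟩ => h ?_⟩
    rw [← ptTyp_same x _ _ h1, ← hmk, h2, hmk]

end wr

theorem card_centralizer_wreath (G : Type*) [Group G] [Finite G] (m : ℕ) (hm : 1 ≤ m)
    (x : Wreath G m) :
    Nat.card (Subgroup.centralizer ({x} : Set (Wreath G m))) =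
      ∏ k ∈ Finset.Icc 1 m, ∏ᶠ c : ConjClasses G,
        (k * Nat.card (Subgroup.centralizer ({Quotient.out c} : Set G))) ^ (mCount x k c) *
          Nat.factorial (mCount x k c) := by
  classical
  let S := Equiv.Perm.SameCycle.setoid x.right
  let Q := Quotient S
  have : Finite Q := Quotient.finite _
  have : Fintype Q := Fintype.ofFinite Q
  have : Fintype (ConjClasses G) := Fintype.ofFinite _
  let typ : Q → ℕ × ConjClasses G := Quotient.lift (ptTyp x) (ptTyp_same x)
  let r : Fin m × G → Q := fun p => Quotient.mk S p.1
  let b : Q → Fin m × G := fun q => (q.out, 1)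
  have hout : ∀ q : Q, ptTyp x q.out = typ q := fun q => by
    conv_rhs => rw [← Quotient.out_eq q]
    rfl
  have hcount : ∀ k c, k ≠ 0 → mCount x k c = Nat.card {q // typ q = (k, c)} := by
    intro k c hk
    rw [mCount]
    apply Nat.div_eq_of_eq_mul_left (Nat.pos_of_ne_zero hk)
    let f : {a : Fin m // Function.minimalPeriod (⇑x.right) a = k ∧
      ConjClasses.mk (cycleProd x.left x.right a) = c} → {q // typ q = (k, c)} :=
      fun a => ⟨Quotient.mk S a.1, Prod.ext a.2.1 a.2.2⟩
    rw [← Nat.card_congr (Equiv.sigmaFiberEquiv f), Nat.card_sigma]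
    rw [Finset.sum_congr rfl (g := fun _ => k)]
    · rw [Finset.sum_const, smul_eq_mul, Finset.card_univ, ← Nat.card_eq_fintype_card]
    · rintro ⟨q, hq⟩ _
      have h1 : Function.minimalPeriod x.right q.out = k := congrArg Prod.fst ((hout q).trans hq)
      refine Eq.trans ?_ ((card_cyc x.right q.out).trans h1)
      refine Nat.card_congr ⟨fun a => ⟨a.1.1, ?_⟩, fun j => ⟨⟨j.1, ?_⟩, ?_⟩, fun _ => rfl, fun _ => rfl⟩
      · have := congrArg Subtype.val a.2
        refine Quotient.exact (s := S) (this.trans (Quotient.out_eq q).symm)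
      · have h2 := (ptTyp_same x _ _ j.2).trans ((hout q).trans hq)
        exact ⟨congrArg Prod.fst h2, congrArg Prod.snd h2⟩
      · apply Subtype.ext
        exact (Quotient.sound (s := S) j.2).trans (Quotient.out_eq q)
  rw [card_cent, abs_count (bigAct x) r b (fun q => Quotient.out_eq q)
    (fun p p' => by rw [← orb_iff]; exact Quotient.eq (r := S)) (ptInv x) (ptInv_iff x) typ
    (fun t => t.1 * Nat.card (Subgroup.centralizer ({Quotient.out t.2} : Set G))) ?_]
  · simp_rw [finprod_eq_prod_of_fintype]
    rw [← Finset.prod_product']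
    rw [Finset.prod_subset (s₂ := Finset.Icc 1 m ×ˢ Finset.univ)]
    · refine Finset.prod_congr rfl ?_
      rintro ⟨k, c⟩ hk
      simp only [Finset.mem_product, Finset.mem_Icc] at hk
      rw [hcount k c (by omega)]
    · intro t ht
      obtain ⟨q, -, rfl⟩ := Finset.mem_image.1 ht
      rw [← hout]
      simp only [Finset.mem_product, Finset.mem_Icc, Finset.mem_univ, and_true]
      refine ⟨per_pos _ _, ?_⟩
      have : (ptTyp x q.out).1 = Function.minimalPeriod x.right q.out := rfl
      rw [this, ← card_cyc]
      exact (Finite.card_subtype_le _).trans (by simp)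
    · intro t _ ht
      have : Nat.card {q // typ q = t} = 0 := by
        rw [Nat.card_eq_zero]
        left
        exact ⟨fun q => ht (Finset.mem_image.2 ⟨q.1, Finset.mem_univ _, q.2⟩)⟩
      rw [this]; simp
  · intro q q'
    have h := card_fib x q'.out (b q)
    rw [hout, show (b q).1 = q.out from rfl, hout] at h
    rw [← h]
    refine Nat.card_congr (Equiv.subtypeEquivRight fun p => and_congr_left fun _ => ?_)
    conv_lhs => rw [← Quotient.out_eq q']
    exact Quotient.eq (r := S)
end

section
/- Let G be a finite group and m ≥ 1. For (h; σ) ∈ G ≀ S_m, the centralizer of (h; σ) in G ≀ S_m is isomorphic, as a group, to ∏_{k=1}^{m} ∏_{c ∈ ConjClasses(G)} ((C_G(x_c))^{(k; x_c)} ≀ S_{m_{k,c}(h;σ)}), where x_c is a representative of the conjugacy class c, C_G(x_c) is its centralizer in G (so that x_c is central in C_G(x_c)), and factors with m_{k,c}(h; σ) = 0 are trivial groups. -/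
/-- `H^{(k;z)}`: the group obtained from `H` by adjoining a central `k`-th root of the
(central) element `z`, i.e. the quotient of `H × ℤ` by the (for central `z`, central)
subgroup generated by `(z⁻¹, k)`. -/
abbrev RootExt (H : Type*) [Group H] (z : H) (k : ℕ) : Type _ :=
  (H × Multiplicative ℤ) ⧸
    Subgroup.normalClosure {((z⁻¹, Multiplicative.ofAdd (k : ℤ)) : H × Multiplicative ℤ)}

namespace CentWreath

/-- The group of permutations of `X` commuting with the action of `M`. -/
def eqAut (M X : Type*) [Group M] [MulAction M X] : Subgroup (Equiv.Perm X) where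
  carrier := {f | ∀ (m : M) (x : X), f (m • x) = m • f x}
  one_mem' := fun m x => rfl
  mul_mem' := by
    intro f g hf hg m x
    simp only [Equiv.Perm.mul_apply]
    rw [hg, hf]
  inv_mem' := by
    intro f hf m x
    rw [Equiv.Perm.inv_eq_iff_eq, hf]
    simp

theorem wreath_mul_left {G : Type*} [Group G] {m : ℕ} (w w' : Wreath G m) (i : Fin m) :
    (w * w').left i = w.left i * w'.left (w.right⁻¹ i) := rfl

theorem eqAut_iso {M X ι : Type*} [Group M] [MulAction M X] (n : ι → ℕ) (H : ι → Subgroup M)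
    {R N : ι → Type*} [∀ t, Group (R t)] [∀ t, Group (N t)]
    (j : ∀ t, N t →* M) (q : ∀ t, N t →* R t) (b : ∀ t, Fin (n t) → X)
    (hq : ∀ t, Function.Surjective (q t))
    (hker : ∀ t a, q t a = 1 ↔ j t a ∈ H t)
    (hcomm : ∀ t a h, h ∈ H t → j t a * h = h * j t a)
    (hnorm : ∀ t s m, (∀ h, h ∈ H t ↔ m⁻¹ * h * m ∈ H s) → t = s)
    (hnorm2 : ∀ t m, (∀ h, h ∈ H t ↔ m⁻¹ * h * m ∈ H t) → ∃ a, j t a = m)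
    (hstab : ∀ t i m, m • b t i = b t i ↔ m ∈ H t)
    (hcov : ∀ x, ∃ t i, ∃ m : M, x = m • b t i)
    (hdisj : ∀ t i s i', ∀ m : M, b t i = m • b s i' →
      (⟨t, i⟩ : Σ t, Fin (n t)) = ⟨s, i'⟩) :
    Nonempty ((∀ t, Wreath (R t) (n t)) ≃* eqAut M X) := by
  have key : ∀ w : (∀ t, Wreath (R t) (n t)), ∃ F : X → X, ∀ t i (m : M) a,
      q t a = (w t).left ((w t).right i) →
      F (m • b t i) = m • (j t a)⁻¹ • b t ((w t).right i) := by
    intro w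
    choose T I m hm using hcov
    choose l hl using hq
    refine ⟨fun x => m x • (j (T x) (l (T x) ((w (T x)).left ((w (T x)).right (I x)))))⁻¹ •
      b (T x) ((w (T x)).right (I x)), ?_⟩
    intro t i m' a ha
    have h1 := hm (m' • b t i)
    have h2 : b t i = (m'⁻¹ * m (m' • b t i)) • b (T (m' • b t i)) (I (m' • b t i)) := by
      rw [mul_smul, ← h1, inv_smul_smul]
    have h3 := hdisj _ _ _ _ _ h2
    dsimp only
    generalize m (m' • b t i) = m0 at h2 ⊢
    generalize I (m' • b t i) = i0 at h2 h3 ⊢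
    generalize T (m' • b t i) = t0 at i0 h2 h3 ⊢
    obtain ⟨rfl, h4⟩ := Sigma.mk.inj_iff.1 h3
    obtain rfl := eq_of_heq h4
    have h5 := (hstab _ _ _).1 h2.symm
    generalize hc : l t ((w t).left ((w t).right i)) = a0
    have ha0 : q t a0 = q t a := by rw [← hc, hl, ha]
    have h6 : j t (a * a0⁻¹) ∈ H t := by
      rw [← hker, map_mul, map_inv, ha0, mul_inv_cancel]
    have h7 : (j t a * (m'⁻¹ * m0) * (j t a0)⁻¹) • b t ((w t).right i) =
        b t ((w t).right i) := by
      rw [hstab, hcomm _ _ _ h5, mul_assoc, ← map_inv, ← map_mul]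
      exact mul_mem h5 h6
    conv_rhs => rw [← h7]
    simp only [← mul_smul]
    congr 1
    group
  choose F hF using key
  have hF' : ∀ w t i (m : M), ∃ a, q t a = (w t).left ((w t).right i) ∧
      F w (m • b t i) = m • (j t a)⁻¹ • b t ((w t).right i) := by
    intro w t i m
    obtain ⟨a, ha⟩ := hq t ((w t).left ((w t).right i))
    exact ⟨a, ha, hF w t i m a ha⟩
  have hF1 : ∀ x, F 1 x = x := by
    intro x
    obtain ⟨t, i, m, rfl⟩ := hcov x
    have := hF 1 t i m 1 (by simp)
    rw [this]
    simp
  have hFm : ∀ w w' x, F (w * w') x = F w (F w' x) := by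
    intro w w' x
    obtain ⟨t, i, m, rfl⟩ := hcov x
    obtain ⟨a, ha, h1⟩ := hF' w' t i m
    rw [h1, ← mul_smul]
    obtain ⟨a', ha', h2⟩ := hF' w t ((w' t).right i) (m * (j t a)⁻¹)
    rw [h2]
    rw [hF (w * w') t i m (a' * a)]
    · simp [mul_smul]
    · rw [map_mul, ha, ha', Pi.mul_apply, wreath_mul_left]
      simp
  have hFe : ∀ w (m : M) x, F w (m • x) = m • F w x := by
    intro w m x
    obtain ⟨t, i, m', rfl⟩ := hcov x
    obtain ⟨a, ha⟩ := hq t ((w t).left ((w t).right i))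
    rw [hF w t i m' a ha, ← mul_smul, hF w t i _ a ha, mul_smul]
  let Φ : (∀ t, Wreath (R t) (n t)) →* eqAut M X :=
    { toFun := fun w => ⟨⟨F w, F w⁻¹, fun x => by rw [← hFm, inv_mul_cancel, hF1],
        fun x => by rw [← hFm, mul_inv_cancel, hF1]⟩, hFe w⟩
      map_one' := by ext x; exact hF1 x
      map_mul' := fun w w' => by ext x; exact hFm w w' x }
  have hΦ : ∀ w x, (Φ w : Equiv.Perm X) x = F w x := fun w x => rfl
  refine ⟨MulEquiv.ofBijective Φ ⟨?_, ?_⟩⟩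
  · rw [injective_iff_map_eq_one]
    intro w hw
    have hw' : ∀ x, F w x = x := fun x => by rw [← hΦ, hw]; rfl
    have hr : ∀ t i, (w t).right i = i ∧ (w t).left i = 1 := by
      intro t i
      obtain ⟨a, ha, h1⟩ := hF' w t i 1
      rw [hw', one_smul, one_smul] at h1
      have h2 := hdisj _ _ _ _ _ h1
      have h3 : (w t).right i = i := by
        have := (Sigma.mk.inj_iff.1 h2).2
        exact (eq_of_heq this).symm
      rw [h3] at h1 ha
      refine ⟨h3, ?_⟩
      rw [← ha, hker]
      have := (hstab _ _ _).1 h1.symm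
      exact inv_mem_iff.1 this
    funext t
    apply SemidirectProduct.ext
    · funext i; exact (hr t i).2
    · ext i; rw [(hr t i).1]; rfl
  · intro f
    have hf := f.2
    have h1 : ∀ t i, ∃ (i' : Fin (n t)) (a : N t), f.1 (b t i) = (j t a)⁻¹ • b t i' := by
      intro t i
      obtain ⟨s, i', m, hm⟩ := hcov (f.1 (b t i))
      have hc : ∀ h, h ∈ H t ↔ m⁻¹ * h * m ∈ H s := by
        intro h
        rw [← hstab t i, ← hstab s i', mul_smul, mul_smul, ← hm, inv_smul_eq_iff, ← hm,
          ← hf, f.1.injective.eq_iff]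
      obtain rfl := hnorm _ _ _ hc
      obtain ⟨a, rfl⟩ := hnorm2 _ _ hc
      exact ⟨i', a⁻¹, by rw [hm, map_inv, inv_inv]⟩
    choose σ a hσ using h1
    have hinj : ∀ t, Function.Injective (σ t) := by
      intro t i i' hii
      have e1 := hσ t i
      have e2 := hσ t i'
      rw [← hii, eq_inv_smul_iff, ← hf] at e2
      rw [← e2, ← hf, f.1.injective.eq_iff, ← mul_smul] at e1
      exact eq_of_heq (Sigma.mk.inj_iff.1 (hdisj _ _ _ _ _ e1)).2
    let τ : ∀ t, Equiv.Perm (Fin (n t)) := fun t =>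
      Equiv.ofBijective (σ t) (Finite.injective_iff_bijective.1 (hinj t))
    refine ⟨fun t => ⟨fun i => q t (a t ((τ t)⁻¹ i)), τ t⟩, ?_⟩
    ext x
    rw [hΦ]
    obtain ⟨t, i, m, rfl⟩ := hcov x
    rw [hf, hσ]
    apply hF
    simp

/-- The free right `G`-set of rank `m`. -/
@[ext]
structure FX (G : Type*) (m : ℕ) where
  /-- the position -/
  pos : Fin m
  /-- the frame -/
  fr : G

/-- The action of the wreath product on the free right `G`-set. -/
instance wAct (G : Type*) [Group G] (m : ℕ) : MulAction (Wreath G m) (FX G m) where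
  smul w p := ⟨w.right p.pos, w.left (w.right p.pos) * p.fr⟩
  one_smul := fun p => by
    change FX.mk _ _ = _
    apply FX.ext <;> simp
  mul_smul := fun w w' p => by
    change FX.mk _ _ = FX.mk _ (w.left (w.right (w'.right p.pos)) *
      (w'.left (w'.right p.pos) * p.fr))
    apply FX.ext
    · rfl
    · simp [wreath_mul_left, mul_assoc]

theorem wsmul_def {G : Type*} [Group G] {m : ℕ} (w : Wreath G m) (p : FX G m) :
    w • p = ⟨w.right p.pos, w.left (w.right p.pos) * p.fr⟩ := rfl

/-- Right multiplication. -/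
def rmul {G : Type*} [Group G] {m : ℕ} (p : FX G m) (g : G) : FX G m := ⟨p.pos, p.fr * g⟩

theorem rmul_one {G : Type*} [Group G] {m : ℕ} (p : FX G m) : rmul p 1 = p :=
  FX.ext rfl (mul_one _)

theorem rmul_rmul {G : Type*} [Group G] {m : ℕ} (p : FX G m) (g h : G) :
    rmul (rmul p g) h = rmul p (g * h) := FX.ext rfl (mul_assoc _ _ _)

theorem smul_rmul {G : Type*} [Group G] {m : ℕ} (w : Wreath G m) (p : FX G m) (g : G) :
    w • (rmul p g) = rmul (w • p) g := FX.ext rfl (mul_assoc _ _ _).symm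

/-- The action of `G × ℤ`. -/
@[reducible]
def zAct {G : Type*} [Group G] {m : ℕ} (x : Wreath G m) :
    MulAction (G × Multiplicative ℤ) (FX G m) where
  smul a p := rmul (x ^ (Multiplicative.toAdd a.2) • p) a.1⁻¹
  one_smul := fun p => by
    change rmul (x ^ (0 : ℤ) • p) 1⁻¹ = p
    simp [rmul_one]
  mul_smul := fun a b p => by
    change rmul (x ^ (Multiplicative.toAdd a.2 + Multiplicative.toAdd b.2) • p) (a.1 * b.1)⁻¹
      = rmul (x ^ (Multiplicative.toAdd a.2) •
          rmul (x ^ (Multiplicative.toAdd b.2) • p) b.1⁻¹) a.1⁻¹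
    rw [smul_rmul, rmul_rmul, zpow_add, mul_smul, mul_inv_rev]

theorem centralizer_iso {G : Type*} [Group G] {m : ℕ} (x : Wreath G m) :
    letI := zAct x
    Nonempty (Subgroup.centralizer ({x} : Set (Wreath G m)) ≃*
      eqAut (G × Multiplicative ℤ) (FX G m)) := by
  let _ := zAct x
  have hsm : ∀ (a : G × Multiplicative ℤ) (p : FX G m),
    a • p = rmul (x ^ (Multiplicative.toAdd a.2) • p) a.1⁻¹ := fun _ _ => rfl
  have hcent : ∀ w : Subgroup.centralizer ({x} : Set (Wreath G m)), Commute w.1 x := by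
    intro w
    have := Subgroup.mem_centralizer_iff.1 w.2 x rfl
    exact this.symm
  let Φ : Subgroup.centralizer ({x} : Set (Wreath G m)) →*
      eqAut (G × Multiplicative ℤ) (FX G m) :=
    { toFun := fun w => ⟨MulAction.toPerm (β := FX G m) w.1, fun a p => by
        simp only [MulAction.toPerm_apply]
        rw [hsm, hsm, smul_rmul, ← mul_smul, ← mul_smul,
          ((hcent w).zpow_right _).eq]⟩
      map_one' := by
        apply Subtype.ext
        apply Equiv.ext
        intro p
        exact one_smul (Wreath G m) p
      map_mul' := fun w w' => by
        apply Subtype.ext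
        apply Equiv.ext
        intro p
        exact mul_smul w.1 w'.1 p }
  have hfaith : ∀ w w' : Wreath G m, (∀ p : FX G m, w • p = w' • p) → w = w' := by
    intro w w' h
    have h1 : w.right = w'.right := by
      ext a
      have := congrArg FX.pos (h ⟨a, 1⟩)
      exact congrArg Fin.val this
    apply SemidirectProduct.ext
    · funext a
      have := congrArg FX.fr (h ⟨w.right⁻¹ a, 1⟩)
      change w.left (w.right (w.right⁻¹ a)) * 1 = w'.left (w'.right (w.right⁻¹ a)) * 1 at this
      rw [← h1] at this
      simpa using this
    · exact h1
  refine ⟨MulEquiv.ofBijective Φ ⟨?_, ?_⟩⟩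
  · intro w w' h
    apply Subtype.ext
    apply hfaith
    intro p
    exact congrArg (fun f => f.1 p) h
  · intro f
    have hfg : ∀ p g, f.1 (rmul p g) = rmul (f.1 p) g := by
      intro p g
      have := f.2 (g⁻¹, 1) p
      rw [hsm, hsm] at this
      simpa using this
    have hfx : ∀ p, f.1 (x • p) = x • f.1 p := by
      intro p
      have := f.2 (1, Multiplicative.ofAdd 1) p
      rw [hsm, hsm] at this
      simpa [rmul_one] using this
    let σ : Fin m → Fin m := fun a => (f.1 ⟨a, 1⟩).pos
    let h : Fin m → G := fun a => (f.1 ⟨a, 1⟩).fr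
    have hσ : Function.Injective σ := by
      intro a a' haa
      have e : f.1 ⟨a, 1⟩ = rmul (f.1 ⟨a', 1⟩) ((h a')⁻¹ * h a) := by
        apply FX.ext
        · exact haa
        · change h a = h a' * ((h a')⁻¹ * h a)
          group
      rw [← hfg, f.1.injective.eq_iff] at e
      exact congrArg FX.pos e
    let τ : Equiv.Perm (Fin m) :=
      Equiv.ofBijective σ (Finite.injective_iff_bijective.1 hσ)
    let w : Wreath G m := ⟨fun i => h (τ⁻¹ i), τ⟩
    have hw : ∀ p, w • p = f.1 p := by
      intro p
      have e : p = rmul ⟨p.pos, 1⟩ p.fr := FX.ext rfl (one_mul _).symm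
      conv_rhs => rw [e, hfg]
      apply FX.ext
      · rfl
      · change h (τ⁻¹ (τ p.pos)) * p.fr = h p.pos * p.fr
        simp
    refine ⟨⟨w, ?_⟩, ?_⟩
    · rw [Subgroup.mem_centralizer_iff]
      rintro y rfl
      apply hfaith
      intro p
      rw [mul_smul, mul_smul, hw, hw, hfx]
    · apply Subtype.ext
      apply Equiv.ext
      intro p
      exact hw p

theorem pow_smul_fx {G : Type*} [Group G] {m : ℕ} (x : Wreath G m) (a : Fin m) (g : G) (n : ℕ) :
    x ^ n • (⟨x.right⁻¹ a, g⟩ : FX G m) = ⟨x.right⁻¹ ((x.right ^ n) a),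
      (((List.range n).reverse).map fun i => x.left ((x.right ^ i) a)).prod * g⟩ := by
  induction n with
  | zero => simp
  | succ n ih =>
    rw [pow_succ', mul_smul, ih, wsmul_def]
    apply FX.ext
    · simp [pow_succ']
    · simp [List.range_succ, mul_assoc]

theorem iter_eq {m : ℕ} (σ : Equiv.Perm (Fin m)) (n : ℕ) (a : Fin m) :
    (⇑σ)^[n] a = (σ ^ n) a := by
  rw [Equiv.Perm.iterate_eq_pow]

theorem mem_periodic {m : ℕ} (σ : Equiv.Perm (Fin m)) (a : Fin m) :
    a ∈ Function.periodicPts (⇑σ) :=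
  σ.injective.mem_periodicPts a

theorem period_smul_fx {G : Type*} [Group G] {m : ℕ} (x : Wreath G m) (a : Fin m) (g : G) :
    x ^ (Function.minimalPeriod (⇑x.right) a) • (⟨x.right⁻¹ a, g⟩ : FX G m) =
      ⟨x.right⁻¹ a, cycleProd x.left x.right a * g⟩ := by
  rw [pow_smul_fx]
  apply FX.ext
  · have := Function.iterate_minimalPeriod (f := ⇑x.right) (x := a)
    rw [iter_eq] at this
    simp [this]
  · rfl

theorem zpow_smul_pos {G : Type*} [Group G] {m : ℕ} (x : Wreath G m) (p : FX G m) (n : ℤ) :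
    (x ^ n • p).pos = (x.right ^ n) p.pos := by
  have : (x ^ n).right = x.right ^ n := map_zpow SemidirectProduct.rightHom x n
  rw [← this]
  rfl

theorem mk_cycleProd_apply {G : Type*} [Group G] {m : ℕ} (x : Wreath G m) (a : Fin m) :
    ConjClasses.mk (cycleProd x.left x.right (x.right a)) =
      ConjClasses.mk (cycleProd x.left x.right a) := by
  have h1 := period_smul_fx x a 1
  have h2 := period_smul_fx x (x.right a) (x.left a)
  rw [Function.minimalPeriod_apply (mem_periodic _ _)] at h2
  have h3 : (⟨x.right⁻¹ (x.right a), x.left a⟩ : FX G m) = x • ⟨x.right⁻¹ a, 1⟩ := by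
    rw [wsmul_def]; simp
  rw [h3, ← mul_smul, ← pow_succ, pow_succ', mul_smul, h1, wsmul_def] at h2
  have h4 := congrArg FX.fr h2
  have h5 : x.right (x.right⁻¹ a) = a := by simp
  simp only [h5, mul_one] at h4
  rw [ConjClasses.mk_eq_mk_iff_isConj, isConj_iff]
  refine ⟨(x.left a)⁻¹, ?_⟩
  rw [inv_inv, mul_assoc, ← h4]
  group

theorem exists_frame {G : Type*} [Group G] {m : ℕ} (x : Wreath G m) (a : Fin m) :
    ∃ p : FX G m, p.pos = x.right⁻¹ a ∧ x ^ (Function.minimalPeriod (⇑x.right) a) • p =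
      rmul p (Quotient.out (ConjClasses.mk (cycleProd x.left x.right a))) := by
  have h : ConjClasses.mk (Quotient.out (ConjClasses.mk (cycleProd x.left x.right a))) =
      ConjClasses.mk (cycleProd x.left x.right a) := Quotient.out_eq _
  rw [ConjClasses.mk_eq_mk_iff_isConj, isConj_iff] at h
  obtain ⟨u, hu⟩ := h
  refine ⟨⟨x.right⁻¹ a, u⟩, rfl, ?_⟩
  rw [period_smul_fx]
  apply FX.ext
  · rfl
  · change _ = u * _
    conv_lhs => rw [← hu]
    group

theorem stab_iff {G : Type*} [Group G] {m : ℕ} (x : Wreath G m) (p : FX G m) (z : G) (k : ℕ)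
    (hk : Function.minimalPeriod (⇑x.right) p.pos = k) (hp : x ^ k • p = rmul p z)
    (a : G × Multiplicative ℤ) :
    letI := zAct x
    a • p = p ↔ a ∈ Subgroup.zpowers ((z, Multiplicative.ofAdd (k : ℤ)) :
      G × Multiplicative ℤ) := by
  let _ := zAct x
  have hsm : ∀ (a : G × Multiplicative ℤ) (p : FX G m),
    a • p = rmul (x ^ (Multiplicative.toAdd a.2) • p) a.1⁻¹ := fun _ _ => rfl
  have hle : Subgroup.zpowers ((z, Multiplicative.ofAdd (k : ℤ)) : G × Multiplicative ℤ) ≤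
      MulAction.stabilizer (G × Multiplicative ℤ) p := by
    rw [Subgroup.zpowers_le, MulAction.mem_stabilizer_iff, hsm]
    simp [hp, rmul_rmul, rmul_one]
  constructor
  · intro h
    have h1 := congrArg FX.pos h
    rw [hsm] at h1
    change (x ^ (Multiplicative.toAdd a.2) • p).pos = p.pos at h1
    rw [zpow_smul_pos] at h1
    have h2 : ((Function.minimalPeriod (x.right • ·) p.pos : ℕ) : ℤ) ∣ Multiplicative.toAdd a.2 :=
      MulAction.zpow_smul_eq_iff_minimalPeriod_dvd.1 h1
    change ((Function.minimalPeriod (⇑x.right) p.pos : ℕ) : ℤ) ∣ Multiplicative.toAdd a.2 at h2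
    rw [hk] at h2
    obtain ⟨d, hd⟩ := h2
    set y : G × Multiplicative ℤ := (z, Multiplicative.ofAdd (k : ℤ)) with hy
    have h3 : y ^ d • p = p := hle (Subgroup.zpow_mem_zpowers y d)
    have h4 : (a * (y ^ d)⁻¹) • p = p := by
      rw [mul_smul, inv_smul_eq_iff.2 h3.symm, h]
    have h5 : (a * (y ^ d)⁻¹).2 = 1 := by
      apply Multiplicative.toAdd.injective
      simp [hy, hd, mul_comm]
    rw [hsm, h5] at h4
    have h6 := congrArg FX.fr h4
    simp [rmul] at h6
    have h7 : a = y ^ d := by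
      apply mul_inv_eq_one.1
      apply Prod.ext
      · have h8 := inv_eq_one.2 h6
        simpa using h8
      · exact h5
    rw [h7]
    exact Subgroup.zpow_mem_zpowers y d
  · intro h
    exact hle h

theorem mem_zp {G : Type*} [Group G] (z : G) (k : ℕ) (a : G × Multiplicative ℤ) :
    a ∈ Subgroup.zpowers ((z, Multiplicative.ofAdd (k : ℤ)) : G × Multiplicative ℤ) ↔
      ∃ d : ℤ, a.1 = z ^ d ∧ Multiplicative.toAdd a.2 = k * d := by
  rw [Subgroup.mem_zpowers_iff]
  constructor
  · rintro ⟨d, rfl⟩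
    exact ⟨d, by simp, by simp [mul_comm]⟩
  · rintro ⟨d, h1, h2⟩
    refine ⟨d, Prod.ext (by simp [h1]) ?_⟩
    apply Multiplicative.toAdd.injective
    simp [h2, mul_comm]

theorem zp_conj {G : Type*} [Group G] (z z' : G) (k k' : ℕ) (hk : 0 < k) (hk' : 0 < k')
    (a : G × Multiplicative ℤ)
    (h : ∀ y, y ∈ Subgroup.zpowers ((z, Multiplicative.ofAdd (k : ℤ)) : G × Multiplicative ℤ) ↔
      a⁻¹ * y * a ∈
        Subgroup.zpowers ((z', Multiplicative.ofAdd (k' : ℤ)) : G × Multiplicative ℤ)) :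
    k = k' ∧ a.1⁻¹ * z * a.1 = z' := by
  have h1 := (h _).1 (Subgroup.mem_zpowers _)
  have h2 := (h (a * (z', Multiplicative.ofAdd (k' : ℤ)) * a⁻¹)).2 (by
    have : a⁻¹ * (a * (z', Multiplicative.ofAdd (k' : ℤ)) * a⁻¹) * a =
      (z', Multiplicative.ofAdd (k' : ℤ)) := by group
    rw [this]
    exact Subgroup.mem_zpowers _)
  rw [mem_zp] at h1 h2
  obtain ⟨d, h1, h3⟩ := h1
  obtain ⟨e, h2, h4⟩ := h2
  simp at h1 h2 h3 h4
  have hkk : k = k' := by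
    apply Nat.dvd_antisymm
    · exact Int.natCast_dvd_natCast.1 ⟨e, h4⟩
    · exact Int.natCast_dvd_natCast.1 ⟨d, h3⟩
  subst hkk
  have hd : d = 1 := by
    have : (k : ℤ) * d = k * 1 := by rw [← h3, mul_one]
    exact mul_left_cancel₀ (by positivity) this
  subst hd
  exact ⟨rfl, by simpa using h1⟩

/-- The type of a cycle. -/
noncomputable def cycType {G : Type*} [Group G] {m : ℕ} (x : Wreath G m) (a : Fin m) :
    Fin m × ConjClasses G :=
  (⟨Function.minimalPeriod (⇑x.right) a - 1, by
    have h1 := Function.minimalPeriod_pos_of_mem_periodicPts (mem_periodic x.right a)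
    have h2 : Function.minimalPeriod (⇑x.right) a ≤ Fintype.card (Fin m) :=
      Function.minimalPeriod_le_card
    rw [Fintype.card_fin] at h2
    omega⟩, ConjClasses.mk (cycleProd x.left x.right a))

theorem cycType_eq_iff {G : Type*} [Group G] {m : ℕ} (x : Wreath G m) (a : Fin m)
    (t : Fin m × ConjClasses G) : cycType x a = t ↔
      Function.minimalPeriod (⇑x.right) a = t.1 + 1 ∧
        ConjClasses.mk (cycleProd x.left x.right a) = t.2 := by
  have h1 := Function.minimalPeriod_pos_of_mem_periodicPts (mem_periodic x.right a)
  rw [Prod.ext_iff, Fin.ext_iff]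
  apply and_congr
  · simp only [cycType]
    omega
  · rfl

theorem cycType_same {G : Type*} [Group G] {m : ℕ} (x : Wreath G m) (a b : Fin m)
    (h : x.right.SameCycle a b) : cycType x a = cycType x b := by
  obtain ⟨i, -, rfl⟩ := h.exists_pow_eq'
  clear h
  induction i with
  | zero => simp
  | succ i ih =>
    rw [ih, eq_comm, cycType_eq_iff, pow_succ', Equiv.Perm.mul_apply]
    obtain ⟨h1, h2⟩ := (cycType_eq_iff x ((x.right ^ i) a) _).1 rfl
    exact ⟨by rw [Function.minimalPeriod_apply (mem_periodic _ _), h1],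
      by rw [mk_cycleProd_apply, h2]⟩

/-- The set of cycles. -/
abbrev Cyc {m : ℕ} (σ : Equiv.Perm (Fin m)) : Type :=
  Quotient (Equiv.Perm.SameCycle.setoid σ)

/-- The type of a cycle. -/
noncomputable def cycTypeQ {G : Type*} [Group G] {m : ℕ} (x : Wreath G m) (ω : Cyc x.right) :
    Fin m × ConjClasses G :=
  Quotient.lift (cycType x) (fun a b h => cycType_same x a b h) ω

theorem card_cycle {m : ℕ} (σ : Equiv.Perm (Fin m)) (ω : Cyc σ) :
    Nat.card {a : Fin m // (Quotient.mk _ a : Cyc σ) = ω} =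
      Function.minimalPeriod (⇑σ) ω.out := by
  classical
  obtain ⟨a, rfl⟩ : ∃ a, a = ω.out := ⟨_, rfl⟩
  have h1 := MulAction.minimalPeriod_eq_card (a := σ) (b := ω.out)
  change Function.minimalPeriod (⇑σ) ω.out = _ at h1
  rw [h1, ← Nat.card_eq_fintype_card]
  apply Nat.card_congr
  apply Equiv.subtypeEquivRight
  intro a
  conv_lhs => rw [← ω.out_eq]
  rw [Quotient.eq, MulAction.mem_orbit_iff]
  constructor
  · intro h
    obtain ⟨i, hi⟩ := Equiv.Perm.SameCycle.symm h
    exact ⟨⟨σ ^ i, Subgroup.zpow_mem_zpowers σ i⟩, hi⟩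
  · rintro ⟨⟨y, hy⟩, h⟩
    obtain ⟨i, rfl⟩ := Subgroup.mem_zpowers_iff.1 hy
    exact Equiv.Perm.SameCycle.symm ⟨i, h⟩

theorem mCount_eq {G : Type*} [Group G] {m : ℕ} (x : Wreath G m) (t : Fin m × ConjClasses G) :
    mCount x (t.1 + 1) t.2 = Nat.card {ω : Cyc x.right // cycTypeQ x ω = t} := by
  classical
  unfold mCount
  apply Nat.div_eq_of_eq_mul_left (Nat.succ_pos _)
  have e : {a : Fin m // Function.minimalPeriod (⇑x.right) a = t.1 + 1 ∧
      ConjClasses.mk (cycleProd x.left x.right a) = t.2} ≃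
      Σ ω : {ω : Cyc x.right // cycTypeQ x ω = t},
        {a : Fin m // (Quotient.mk _ a : Cyc x.right) = ω.1} :=
    { toFun := fun a => ⟨⟨Quotient.mk _ a.1, (cycType_eq_iff x a.1 t).2 a.2⟩, ⟨a.1, rfl⟩⟩
      invFun := fun s => ⟨s.2.1, (cycType_eq_iff x s.2.1 t).1 (by
        have h1 := s.1.2
        rw [← s.2.2] at h1
        exact h1)⟩
      left_inv := fun a => rfl
      right_inv := by
        rintro ⟨⟨ω, hω⟩, ⟨a, ha⟩⟩
        change Quotient.mk _ a = ω at ha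
        subst ha
        rfl }
  have : Fintype {ω : Cyc x.right // cycTypeQ x ω = t} := Fintype.ofFinite _
  rw [Nat.card_congr e, Nat.card_sigma]
  rw [Finset.sum_congr rfl (g := fun _ => (t.1 : ℕ) + 1)]
  · simp
  · rintro ⟨ω, hω⟩ -
    rw [card_cycle]
    rw [← ω.out_eq] at hω
    exact ((cycType_eq_iff x _ t).1 hω).1

theorem mem_nc {G : Type*} [Group G] (z : G) (hz : z ∈ Subgroup.centralizer ({z} : Set G)) (k : ℕ)
    (a : Subgroup.centralizer ({z} : Set G) × Multiplicative ℤ) :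
    a ∈ Subgroup.normalClosure {(((⟨z, hz⟩ : Subgroup.centralizer ({z} : Set G))⁻¹,
        Multiplicative.ofAdd (k : ℤ)) : Subgroup.centralizer ({z} : Set G) × Multiplicative ℤ)} ↔
      ((a.1.1, a.2⁻¹) : G × Multiplicative ℤ) ∈
        Subgroup.zpowers ((z, Multiplicative.ofAdd (k : ℤ)) : G × Multiplicative ℤ) := by
  set y : Subgroup.centralizer ({z} : Set G) × Multiplicative ℤ :=
    ((⟨z, hz⟩ : Subgroup.centralizer ({z} : Set G))⁻¹, Multiplicative.ofAdd (k : ℤ)) with hy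
  have hc : ∀ b, Commute b y := by
    rintro ⟨⟨c, hc⟩, n⟩
    have h2 : Commute z c := Subgroup.mem_centralizer_iff.1 hc _ rfl
    apply Prod.ext
    · apply Subtype.ext
      exact (h2.inv_left.eq).symm
    · exact mul_comm _ _
  have hn : (Subgroup.zpowers y).Normal := by
    constructor
    rintro w hw b
    obtain ⟨i, rfl⟩ := Subgroup.mem_zpowers_iff.1 hw
    rw [((hc b).zpow_right i).eq, mul_inv_cancel_right]
    exact hw
  have he : Subgroup.normalClosure {y} = Subgroup.zpowers y := by
    apply le_antisymm
    · apply Subgroup.normalClosure_le_normal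
      rintro w rfl
      exact Subgroup.mem_zpowers _
    · rw [Subgroup.zpowers_le]
      exact Subgroup.subset_normalClosure rfl
  rw [he, Subgroup.mem_zpowers_iff, mem_zp]
  constructor
  · rintro ⟨i, rfl⟩
    exact ⟨-i, by simp [hy], by simp [hy, mul_comm]⟩
  · rintro ⟨d, h1, h2⟩
    refine ⟨-d, Prod.ext (Subtype.ext ?_) ?_⟩
    · simpa [hy] using h1.symm
    · apply Multiplicative.toAdd.injective
      simp at h2
      simp [hy]
      linarith

end CentWreath

/-- The centralizer of `(h; σ)` in `G ≀ S_m` is isomorphic to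
`∏_{k=1}^m ∏_c ((C_G(x_c))^{(k; x_c)} ≀ S_{m_{k,c}(h;σ)})`, where `c` runs over the
conjugacy classes of `G` with representative `x_c`. -/
theorem centralizer_wreath_iso (G : Type*) [Group G] [Finite G] (m : ℕ) (hm : 1 ≤ m)
    (x : Wreath G m) :
    Nonempty
      ((Subgroup.centralizer ({x} : Set (Wreath G m))) ≃*
        ∀ k : Fin m, ∀ c : ConjClasses G,
          Wreath
            (RootExt (Subgroup.centralizer ({Quotient.out c} : Set G))
              ⟨Quotient.out c, by simp [Subgroup.mem_centralizer_iff]⟩ ((k : ℕ) + 1))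
            (mCount x ((k : ℕ) + 1) c)) := by
  classical
  let _ := CentWreath.zAct x
  obtain ⟨e1⟩ := CentWreath.centralizer_iso x
  have hE : ∀ t : Fin m × ConjClasses G, Nonempty (Fin (mCount x ((t.1 : ℕ) + 1) t.2) ≃
      {ω : CentWreath.Cyc x.right // CentWreath.cycTypeQ x ω = t}) := fun t =>
    ⟨(finCongr (CentWreath.mCount_eq x t)).trans (Finite.equivFin _).symm⟩
  let E := fun t => (hE t).some
  choose P hP1 hP2 using CentWreath.exists_frame x
  have hout : ∀ t i, Function.minimalPeriod (⇑x.right) (E t i).1.out = (t.1 : ℕ) + 1 ∧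
      ConjClasses.mk (cycleProd x.left x.right (E t i).1.out) = t.2 := by
    intro t i
    rw [← CentWreath.cycType_eq_iff]
    have h := (E t i).2
    rw [← (E t i).1.out_eq] at h
    exact h
  have hcyc : ∀ (a : G × Multiplicative ℤ) (p : CentWreath.FX G m),
      x.right.SameCycle p.pos (a • p).pos := by
    intro a p
    exact ⟨Multiplicative.toAdd a.2, (CentWreath.zpow_smul_pos x p _).symm⟩
  have hinv : ∀ a, x.right.SameCycle a (x.right⁻¹ a) := fun a => ⟨-1, by simp⟩
  obtain ⟨e2⟩ := CentWreath.eqAut_iso (M := G × Multiplicative ℤ) (X := CentWreath.FX G m)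
    (ι := Fin m × ConjClasses G) (fun t => mCount x ((t.1 : ℕ) + 1) t.2)
    (fun t => Subgroup.zpowers
      ((Quotient.out t.2, Multiplicative.ofAdd (((t.1 : ℕ) + 1 : ℕ) : ℤ)) :
        G × Multiplicative ℤ))
    (R := fun t => RootExt (Subgroup.centralizer ({Quotient.out t.2} : Set G))
              ⟨Quotient.out t.2, by simp [Subgroup.mem_centralizer_iff]⟩ ((t.1 : ℕ) + 1))
    (N := fun t => Subgroup.centralizer ({Quotient.out t.2} : Set G) × Multiplicative ℤ)
    (fun t => MonoidHom.prodMap (Subgroup.subtype _) invMonoidHom)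
    (fun t => QuotientGroup.mk' _)
    (fun t i => P (E t i).1.out)
    (fun t => QuotientGroup.mk'_surjective _)
    (by
      intro t a
      rw [← MonoidHom.mem_ker, QuotientGroup.ker_mk', CentWreath.mem_nc]
      rfl)
    (by
      rintro t ⟨⟨c, hc⟩, n⟩ h hh
      rw [CentWreath.mem_zp] at hh
      obtain ⟨d, h1, -⟩ := hh
      have h2 : Commute (Quotient.out t.2) c := Subgroup.mem_centralizer_iff.1 hc _ rfl
      apply Prod.ext
      · change c * h.1 = h.1 * c
        rw [h1]
        exact ((h2.zpow_left d).eq).symm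
      · exact mul_comm _ _)
    (by
      intro t s a h
      obtain ⟨h1, h2⟩ := CentWreath.zp_conj _ _ _ _ (Nat.succ_pos _) (Nat.succ_pos _) a h
      apply Prod.ext
      · apply Fin.ext; omega
      · rw [← Quotient.out_eq t.2, ← Quotient.out_eq s.2]
        apply Quotient.sound
        apply isConj_iff.2
        exact ⟨a.1⁻¹, by rw [inv_inv, h2]⟩)
    (by
      intro t a h
      obtain ⟨h1, h2⟩ := CentWreath.zp_conj _ _ _ _ (Nat.succ_pos _) (Nat.succ_pos _) a h
      refine ⟨(⟨a.1, ?_⟩, a.2⁻¹), ?_⟩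
      · rw [Subgroup.mem_centralizer_iff]
        rintro y rfl
        rw [mul_assoc, inv_mul_eq_iff_eq_mul] at h2
        exact h2
      · apply Prod.ext
        · rfl
        · exact inv_inv _)
    (by
      intro t i a
      obtain ⟨h1, h2⟩ := hout t i
      apply CentWreath.stab_iff
      · rw [hP1]
        have := CentWreath.cycType_same x _ _ (hinv (E t i).1.out)
        exact ((CentWreath.cycType_eq_iff x _ t).1 (this.symm.trans
          ((CentWreath.cycType_eq_iff x _ t).2 ⟨h1, h2⟩))).1
      · have := hP2 (E t i).1.out
        rw [h1, h2] at this
        exact this)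
    (by
      intro p
      let ω : CentWreath.Cyc x.right := Quotient.mk _ p.pos
      let t := CentWreath.cycTypeQ x ω
      let i := (E t).symm ⟨ω, rfl⟩
      have hi : (E t i).1 = ω := by simp [i]
      have h1 : x.right.SameCycle (P (E t i).1.out).pos p.pos := by
        rw [hP1, hi]
        exact (hinv _).symm.trans (Quotient.exact (Quotient.out_eq ω))
      obtain ⟨n, hn⟩ := h1
      have h2 : ∀ r : CentWreath.FX G m, (x.right ^ n) r.pos = p.pos →
          ∃ a : G × Multiplicative ℤ, p = a • r := by
        intro r hr
        refine ⟨(p.fr⁻¹ * (x ^ n • r).fr, Multiplicative.ofAdd n), ?_⟩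
        change p = CentWreath.rmul (x ^ n • r) (p.fr⁻¹ * (x ^ n • r).fr)⁻¹
        apply CentWreath.FX.ext
        · change p.pos = (x ^ n • r).pos
          rw [CentWreath.zpow_smul_pos, hr]
        · change p.fr = (x ^ n • r).fr * (p.fr⁻¹ * (x ^ n • r).fr)⁻¹
          group
      exact ⟨t, i, h2 _ hn⟩)
    (by
      intro t i s i' a h
      have h1 := congrArg CentWreath.FX.pos h
      have h2 := hcyc a (P (E s i').1.out)
      rw [← h1, hP1, hP1] at h2
      have h3 := ((hinv _).trans h2).trans (hinv _).symm
      have h4 : (E s i').1 = (E t i).1 := by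
        rw [← Quotient.out_eq (E s i').1, ← Quotient.out_eq (E t i).1]
        exact Quotient.sound h3
      have h5 : s = t := by rw [← (E s i').2, ← (E t i).2, h4]
      subst h5
      have h6 := (E s).injective (Subtype.ext h4)
      rw [h6])
  refine ⟨(e1.trans e2.symm).trans ?_⟩
  exact
    { toFun := fun w k c => w (k, c)
      invFun := fun w t => w t.1 t.2
      left_inv := fun w => rfl
      right_inv := fun w => rfl
      map_mul' := fun w w' => rfl }
end

section
/- For every m ≥ 4, the second group cohomology H²(S_m; ℚ/ℤ) of the symmetric group S_m with coefficients in ℚ/ℤ with trivial action is isomorphic, as an abelian group, to ℤ/2. -/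
open Equiv in
theorem exists_perm_pair {α : Type*} [DecidableEq α] (a b i j : α) (hab : a ≠ b) (hij : i ≠ j) :
    ∃ h : Perm α, h a = i ∧ h b = j ∧ ∀ z, z ≠ a → z ≠ b → z ≠ i → z ≠ j → h z = z := by
  refine ⟨swap (swap a i b) j * swap a i, ?_, ?_, ?_⟩
  · rw [Perm.mul_apply, swap_apply_left, swap_apply_of_ne_of_ne _ hij]
    intro h
    have := (swap a i).injective ((swap_apply_left a i).trans h)
    exact hab this
  · rw [Perm.mul_apply, swap_apply_left]
  · intro z h1 h2 h3 h4
    rw [Perm.mul_apply, swap_apply_of_ne_of_ne h1 h3, swap_apply_of_ne_of_ne _ h4]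
    rw [swap_apply_def]
    split_ifs <;> assumption

open Equiv in
theorem perm_pres {G : Type*} [Group G] (n : ℕ) : ∀ (T : Fin n → Fin n → G)
    (_ : ∀ i, T i i = 1) (_ : ∀ i j, T i j * T i j = 1) (_ : ∀ i j, T i j = T j i)
    (_ : ∀ i j k l, T i j * T k l = T (swap i j k) (swap i j l) * T i j),
    ∃ σ : Perm (Fin n) →* G, ∀ i j, σ (swap i j) = T i j := by
  induction n with
  | zero => 
    intro T _ _ _ _
    exact ⟨1, fun i => i.elim0⟩
  | succ n ih =>
    intro T h1 h2 h3 h4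
    obtain ⟨σ, hσ⟩ := ih (fun i j => T i.succ j.succ) (fun i => h1 _) (fun i j => h2 _ _)
      (fun i j => h3 _ _) (fun i j k l => by
        have h := h4 i.succ j.succ k.succ l.succ
        rw [h, ← (Fin.succ_injective n).swap_apply, ← (Fin.succ_injective n).swap_apply])
    let F : Perm (Fin (n+1)) → G := fun g =>
      T 0 (Perm.decomposeFin g).1 * σ (Perm.decomposeFin g).2
    let L : Perm (Fin n) → Perm (Fin (n+1)) := fun p => Perm.decomposeFin.symm (0, p)
    have hL : ∀ a p, Perm.decomposeFin.symm (a, p) = swap 0 a * L p := by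
      intro a p
      ext x
      refine Fin.cases ?_ (fun x => ?_) x
      · simp [L]
      · simp [L]
    have hF : ∀ a p, F (swap 0 a * L p) = T 0 a * σ p := by
      intro a p
      rw [← hL]; simp [F]
    have hLs : ∀ x y p, swap x.succ y.succ * L p = L (swap x y * p) := by
      intro x y p
      ext z
      refine Fin.cases ?_ (fun z => ?_) z
      · simp [L, swap_apply_of_ne_of_ne (Fin.succ_ne_zero x).symm (Fin.succ_ne_zero y).symm]
      · simp [L, (Fin.succ_injective n).swap_apply]
    have hF0 : ∀ p, F (L p) = σ p := by
      intro p
      have := hF 0 p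
      rwa [swap_self, ← Perm.one_def, one_mul, h1, one_mul] at this
    have key0 : ∀ b g, F (swap 0 b * g) = T 0 b * F g := by
      intro b g
      obtain ⟨⟨a, p⟩, rfl⟩ := Perm.decomposeFin.symm.surjective g
      rw [hL, hF]
      by_cases ha : a = 0
      · subst ha
        rw [swap_self, ← Perm.one_def, one_mul, h1, one_mul, hF]
      by_cases hb : b = 0
      · subst hb
        rw [swap_self, ← Perm.one_def, one_mul, h1, one_mul, hF]
      by_cases hab : a = b
      · subst hab
        rw [← mul_assoc, ← mul_assoc, swap_mul_self, one_mul, h2, one_mul, hF0]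
      obtain ⟨a, rfl⟩ := Fin.exists_succ_eq.2 ha
      obtain ⟨b, rfl⟩ := Fin.exists_succ_eq.2 hb
      have e1 : swap 0 b.succ * swap 0 a.succ = swap 0 a.succ * swap a.succ b.succ := by
        rw [Equiv.mul_swap_eq_swap_mul (swap 0 a.succ), swap_apply_right,
          swap_apply_of_ne_of_ne hb (Ne.symm hab)]
      have e2 := h4 0 a.succ a.succ b.succ
      rw [swap_apply_right, swap_apply_of_ne_of_ne hb (Ne.symm hab)] at e2
      rw [← mul_assoc, e1, mul_assoc, hLs, hF, map_mul, hσ, ← mul_assoc, e2, mul_assoc]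
    have key : ∀ x y g, F (swap x y * g) = T x y * F g := by
      intro x y g
      refine Fin.cases ?_ (fun x => ?_) x
      · exact key0 y g
      refine Fin.cases ?_ (fun y => ?_) y
      · rw [swap_comm, h3]; exact key0 _ g
      obtain ⟨⟨a, p⟩, rfl⟩ := Perm.decomposeFin.symm.surjective g
      rw [hL, ← mul_assoc, Equiv.mul_swap_eq_swap_mul, mul_assoc, hLs, hF, ← mul_assoc, h4]
      rw [swap_apply_of_ne_of_ne (Fin.succ_ne_zero x).symm (Fin.succ_ne_zero y).symm, hF, map_mul,
        hσ, mul_assoc]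
    have hone : F 1 = 1 := by
      have : (1 : Perm (Fin (n+1))) = L 1 := by simp [L, ← Perm.one_def]
      rw [this, hF0, map_one]
    refine ⟨⟨⟨F, hone⟩, ?_⟩, ?_⟩
    · intro g h
      change F (g * h) = F g * F h
      induction g using Perm.swap_induction_on with
      | one => rw [hone, one_mul, one_mul]
      | swap_mul g x y hxy ihg => rw [mul_assoc, key, ihg, key, mul_assoc (T x y)]
    · intro i j
      change F _ = _
      have := key i j 1
      rwa [hone, mul_one, mul_one] at this

open Equiv in
theorem split_of_comm {E : Type*} [Group E] (m : ℕ) (p : E →* Perm (Fin m))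
    (hp : Function.Surjective p) (hc : ∀ z, p z = 1 → ∀ g, z * g = g * z)
    (hdiv : ∀ z, p z = 1 → ∃ w, p w = 1 ∧ w * w = z)
    (o i₁ i₂ i₃ : Fin m) (h01 : o ≠ i₁) (h23 : i₂ ≠ i₃) (h02 : o ≠ i₂) (h03 : o ≠ i₃)
    (h12 : i₁ ≠ i₂) (h13 : i₁ ≠ i₃)
    (x y : E) (hx : p x = swap o i₁) (hy : p y = swap i₂ i₃) (hxy : x * y = y * x) :
    ∃ σ : Perm (Fin m) →* E, ∀ g, p (σ g) = g := by
  obtain ⟨w, hw, hww⟩ := hdiv (x * x) (by rw [map_mul, hx, swap_mul_self])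
  obtain ⟨τ, hτ, hττ, hτy⟩ : ∃ τ, p τ = swap o i₁ ∧ τ * τ = 1 ∧ τ * y = y * τ := by
    have hw' : p w⁻¹ = 1 := by rw [map_inv, hw, inv_one]
    refine ⟨x * w⁻¹, by rw [map_mul, hw', hx, mul_one], ?_, ?_⟩
    · calc x * w⁻¹ * (x * w⁻¹) = x * (w⁻¹ * x) * w⁻¹ := by group
        _ = (x * x) * w⁻¹ * w⁻¹ := by rw [hc _ hw' x]; group
        _ = 1 := by rw [← hww]; group
    · rw [mul_assoc, hc _ hw' y, ← mul_assoc, hxy, mul_assoc]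
  -- elements lying over permutations fixing `o` and `i₁` commute with `τ`
  have hker : ∀ g g', p g = p g' → g * τ = τ * g → g' * τ = τ * g' := by
    intro g g' hg h
    have hz : p (g' * g⁻¹) = 1 := by rw [map_mul, map_inv, hg, mul_inv_cancel]
    have := hc _ hz
    calc g' * τ = (g' * g⁻¹) * (g * τ) := by group
      _ = (g' * g⁻¹) * τ * g := by rw [h]; group
      _ = τ * g' := by rw [this]; group
  have hswap : ∀ k l, k ≠ l → k ≠ o → k ≠ i₁ → l ≠ o → l ≠ i₁ → ∀ g, p g = swap k l →
      g * τ = τ * g := by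
    intro k l hkl hk0 hk1 hl0 hl1 g hg
    -- a permutation fixing o, i₁ and moving i₂, i₃ to k, l
    obtain ⟨h, e0, e1, e2, e3⟩ : ∃ h : Perm (Fin m), h o = o ∧ h i₁ = i₁ ∧ h i₂ = k ∧ h i₃ = l := by
      obtain ⟨h, e2, e3, e⟩ := exists_perm_pair i₂ i₃ k l h23 hkl
      exact ⟨h, e o h02 h03 hk0.symm hl0.symm, e i₁ h12 h13 hk1.symm hl1.symm, e2, e3⟩
    obtain ⟨t, rfl⟩ := hp h
    have hz : p (t * τ * t⁻¹ * τ⁻¹) = 1 := by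
      have : p t * swap o i₁ = swap o i₁ * p t := by
        rw [Equiv.mul_swap_eq_swap_mul, e0, e1]
      rw [map_mul, map_mul, map_mul, hτ, map_inv, map_inv, hτ, this]; group
    have hz' := hc _ hz
    refine hker (t * y * t⁻¹) g ?_ ?_
    · rw [hg, map_mul, map_mul, map_inv, hy, Equiv.mul_swap_eq_swap_mul, e2, e3]; group
    · have a1 : (t * y * t⁻¹) * (t * τ * t⁻¹) = (t * τ * t⁻¹) * (t * y * t⁻¹) := by
        calc _ = t * (y * τ) * t⁻¹ := by group
          _ = _ := by rw [← hτy]; group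
      have a2 : t * τ * t⁻¹ = (t * τ * t⁻¹ * τ⁻¹) * τ := by group
      generalize t * τ * t⁻¹ * τ⁻¹ = z at *
      rw [a2] at a1
      generalize t * y * t⁻¹ = r at *
      rw [← mul_assoc, ← hz', mul_assoc, mul_assoc] at a1
      exact mul_left_cancel a1
  have hfix : ∀ g, p g o = o → p g i₁ = i₁ → g * τ = τ * g := by
    intro g g0 g1
    let P : Fin m → Prop := fun i => i ≠ o ∧ i ≠ i₁
    have hs : ∀ x, P (p g x) ↔ P x := by
      intro x
      have u0 : p g x = o ↔ x = o := by
        conv_lhs => rw [← g0]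
        exact (p g).injective.eq_iff
      have u1 : p g x = i₁ ↔ x = i₁ := by
        conv_lhs => rw [← g1]
        exact (p g).injective.eq_iff
      simp only [P, ne_eq, u0, u1]
    have hq : ∀ q : Perm {i // P i}, ∀ g, p g = Perm.ofSubtype q → g * τ = τ * g := by
      intro q
      induction q using Perm.swap_induction_on with
      | one => 
        intro g hg
        rw [map_one] at hg
        exact hc g hg τ
      | swap_mul q a b hab ih =>
        intro g hg
        obtain ⟨s, hs⟩ := hp (swap a.1 b.1)
        have c1 := hswap a.1 b.1 (fun h => hab (Subtype.ext h)) a.2.1 a.2.2 b.2.1 b.2.2 s hs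
        have c2 := ih (s⁻¹ * g) (by
          rw [map_mul, map_inv, hs, hg, map_mul, Perm.ofSubtype_swap_eq]; group)
        calc g * τ = s * (s⁻¹ * g * τ) := by group
          _ = s * τ * (s⁻¹ * g) := by rw [c2]; group
          _ = τ * g := by rw [c1]; group
    refine hq (Perm.subtypePerm (p g) hs) g (Perm.ofSubtype_subtypePerm hs ?_).symm
    intro v hv
    refine ⟨?_, ?_⟩
    · rintro rfl; exact hv g0
    · rintro rfl; exact hv g1
  have hwd : ∀ g g', p g o = p g' o → p g i₁ = p g' i₁ → g * τ * g⁻¹ = g' * τ * g'⁻¹ := by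
    intro g g' e0 e1
    have := hfix (g'⁻¹ * g) (by simp [e0]) (by simp [e1])
    calc g * τ * g⁻¹ = g' * ((g'⁻¹ * g) * τ) * g⁻¹ := by group
      _ = _ := by rw [this]; group
  have hex : ∀ i j : Fin m, i ≠ j → ∃ g, p g o = i ∧ p g i₁ = j := by
    intro i j hij
    obtain ⟨h, e0, e1⟩ : ∃ h : Perm (Fin m), h o = i ∧ h i₁ = j := by
      obtain ⟨h, e2, e3, -⟩ := exists_perm_pair o i₁ i j h01 hij
      exact ⟨h, e2, e3⟩
    obtain ⟨g, rfl⟩ := hp h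
    exact ⟨g, e0, e1⟩
  choose! c hc0 hc1 using hex
  let T : Fin m → Fin m → E := fun i j => if i = j then 1 else c i j * τ * (c i j)⁻¹
  have hT : ∀ g, T (p g o) (p g i₁) = g * τ * g⁻¹ := by
    intro g
    have hne : p g o ≠ p g i₁ := fun h => h01 ((p g).injective h)
    simp only [T, if_neg hne]
    exact hwd _ _ (hc0 _ _ hne) (hc1 _ _ hne)
  have hTex : ∀ i j, i ≠ j → ∃ g, p g o = i ∧ p g i₁ = j ∧ T i j = g * τ * g⁻¹ := by
    intro i j hij
    refine ⟨c i j, hc0 i j hij, hc1 i j hij, by simp only [T, if_neg hij]⟩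
  have hT1 : ∀ i, T i i = 1 := fun i => by simp [T]
  have hpT : ∀ i j, p (T i j) = swap i j := by
    intro i j
    by_cases hij : i = j
    · subst hij; rw [hT1, map_one, swap_self]; rfl
    · obtain ⟨g, rfl, rfl, e⟩ := hTex i j hij
      rw [e, map_mul, map_mul, hτ, Equiv.mul_swap_eq_swap_mul, map_inv]; group
  have heq : ∀ g i j, g * T i j = T (p g i) (p g j) * g := by
    intro g i j
    by_cases hij : i = j
    · subst hij; rw [hT1, hT1]; group
    · obtain ⟨h, rfl, rfl, e⟩ := hTex i j hij
      have := hT (g * h)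
      rw [map_mul] at this
      rw [e]
      simp only [Perm.mul_apply] at this
      rw [this]; group
  have hT2 : ∀ i j, T i j * T i j = 1 := by
    intro i j
    by_cases hij : i = j
    · subst hij; rw [hT1, one_mul]
    · obtain ⟨g, rfl, rfl, e⟩ := hTex i j hij
      rw [e]
      calc _ = g * (τ * τ) * g⁻¹ := by group
        _ = 1 := by rw [hττ]; group
  have hT3 : ∀ i j, T i j = T j i := by
    intro i j
    by_cases hij : i = j
    · rw [hij]
    · obtain ⟨g, rfl, rfl, e⟩ := hTex i j hij
      have := hT (g * τ)
      rw [map_mul, hτ] at this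
      simp only [Perm.mul_apply, swap_apply_left, swap_apply_right] at this
      rw [this, e]; group
  obtain ⟨σ, hσ⟩ := perm_pres m T hT1 hT2 hT3 (fun i j k l => by rw [heq, hpT])
  refine ⟨σ, fun g => ?_⟩
  induction g using Perm.swap_induction_on with
  | one => simp
  | swap_mul g a b hab ih => rw [map_mul, map_mul, ih, hσ, hpT]

theorem two7 : (2 : ZMod 7) ≠ 0 := by decide

theorem seven7 : (OfNat.ofNat 7 : ZMod 7) = 0 := by decide

theorem exists_cliff (m : ℕ) : ∃ (R : Type) (_ : Ring R) (e : Fin m → R),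
    (7 : R) = 0 ∧ (1 : R) ≠ -1 ∧ (∀ i, e i * e i = 1) ∧ ∀ i j, i ≠ j → e i * e j = - (e j * e i) := by
  haveI : Fact (Nat.Prime 7) := ⟨by norm_num⟩
  letI : Invertible (2 : ZMod 7) := invertibleOfNonzero two7
  let Q : QuadraticForm (ZMod 7) (Fin m → ZMod 7) :=
    QuadraticMap.weightedSumSquares (ZMod 7) (fun _ => (1 : ZMod 7))
  have h7 : (7 : CliffordAlgebra Q) = 0 := by
    have := map_ofNat (algebraMap (ZMod 7) (CliffordAlgebra Q)) 7
    rw [← this, show (OfNat.ofNat 7 : ZMod 7) = 0 from seven7, map_zero]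
  refine ⟨CliffordAlgebra Q, inferInstance, fun i => CliffordAlgebra.ι Q (Pi.single i 1),
    h7, ?_, ?_, ?_⟩
  · intro h
    have h2 : (2 : CliffordAlgebra Q) = 0 := by
      rw [← one_add_one_eq_two]; nth_rewrite 1 [h]; simp
    have : (1 : CliffordAlgebra Q) = 7 - 2 * 3 := by norm_num
    rw [h7, h2] at this
    simp at this
  · intro i
    rw [CliffordAlgebra.ι_sq_scalar]
    have : Q (Pi.single i 1) = 1 := by
      simp [Q, QuadraticMap.weightedSumSquares_apply, Pi.single_apply]
    rw [this, map_one]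
  · intro i j hij
    apply CliffordAlgebra.ι_mul_ι_comm_of_isOrtho
    rw [QuadraticMap.isOrtho_def]
    simp only [Q, QuadraticMap.weightedSumSquares_apply, ← Finset.sum_add_distrib]
    refine Finset.sum_congr rfl fun k _ => ?_
    by_cases h1 : k = i
    · subst h1; simp [Pi.single_apply, hij]
    · simp [Pi.single_apply, h1]

open Equiv in
theorem cliff_conj {R : Type*} [Ring R] {m : ℕ} (e : Fin m → R)
    (h1 : ∀ i, e i * e i = 1) (h2 : ∀ i j, i ≠ j → e i * e j = - (e j * e i))
    (i j : Fin m) (hij : i ≠ j) (k : Fin m) :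
    (e i - e j) * e k = - (e (swap i j k) * (e i - e j)) := by
  by_cases hki : k = i
  · subst hki
    rw [swap_apply_left, sub_mul, mul_sub, h1, h1]; abel
  by_cases hkj : k = j
  · subst hkj
    rw [swap_apply_right, sub_mul, mul_sub, h1, h1]; abel
  rw [swap_apply_of_ne_of_ne hki hkj, sub_mul, mul_sub, h2 i k (Ne.symm hki),
    h2 j k (Ne.symm hkj)]; abel

open Equiv in
theorem exists_spin (m : ℕ) (o i₁ i₂ i₃ : Fin m) (h01 : o ≠ i₁) (h23 : i₂ ≠ i₃) (h02 : o ≠ i₂)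
    (h03 : o ≠ i₃) (h12 : i₁ ≠ i₂) (h13 : i₁ ≠ i₃) :
    ∃ (U : Type) (_ : Group U) (_ : HasDistribNeg U) (u : Perm (Fin m) → U), (1 : U) ≠ -1 ∧
      (∀ g h, u g * u h = u (g * h) ∨ u g * u h = - u (g * h)) ∧
      u (swap o i₁) * u (swap i₂ i₃) = - (u (swap i₂ i₃) * u (swap o i₁)) := by
  obtain ⟨R, _, e, h7, hne, h1, h2⟩ := exists_cliff m
  have hsq : ∀ i j, i ≠ j → (e i - e j) * (e i - e j) = 2 := by
    intro i j hij
    rw [sub_mul, mul_sub, mul_sub, h1, h1, h2 i j hij, ← one_add_one_eq_two]; abel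
  have hsq2 : ∀ i j, i ≠ j → (2 * (e i - e j)) * (2 * (e i - e j)) = 1 := by
    intro i j hij
    calc _ = 4 * ((e i - e j) * (e i - e j)) := by noncomm_ring
      _ = 7 + 1 := by rw [hsq i j hij]; norm_num
      _ = 1 := by rw [h7, zero_add]
  let V : Fin m → Fin m → Rˣ := fun i j =>
    if h : i = j then 1 else ⟨2 * (e i - e j), 2 * (e i - e j), hsq2 i j h, hsq2 i j h⟩
  have hV1 : ∀ i, V i i = 1 := fun i => by simp [V]
  have hV : ∀ i j, i ≠ j → (V i j : R) = 2 * (e i - e j) := fun i j h => by simp [V, h]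
  have hVsq : ∀ i j, V i j * V i j = 1 := by
    intro i j
    by_cases h : i = j
    · subst h; rw [hV1, one_mul]
    · ext; rw [Units.val_mul, hV i j h, hsq2 i j h, Units.val_one]
  have hVs : ∀ i j, i ≠ j → V i j = - V j i := by
    intro i j h
    ext; rw [Units.val_neg, hV i j h, hV j i h.symm]; noncomm_ring
  have hVc : ∀ i j k l, i ≠ j → k ≠ l →
      V i j * V k l = - (V (swap i j k) (swap i j l) * V i j) := by
    intro i j k l h h'
    ext
    rw [Units.val_neg, Units.val_mul, Units.val_mul, hV i j h, hV k l h', hV _ _ (by simpa using h')]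
    have a := cliff_conj e h1 h2 i j h k
    have b := cliff_conj e h1 h2 i j h l
    calc _ = 4 * ((e i - e j) * e k - (e i - e j) * e l) := by noncomm_ring
      _ = _ := by rw [a, b]; noncomm_ring
  let N : Subgroup Rˣ :=
    { carrier := {x | x = 1 ∨ x = -1}
      mul_mem' := by rintro a b (rfl | rfl) (rfl | rfl) <;> simp
      one_mem' := by simp
      inv_mem' := by rintro a (rfl | rfl) <;> simp }
  haveI : N.Normal := ⟨by
    rintro n (rfl | rfl) g
    · left; simp
    · right; simp⟩
  have hneg : ∀ a : Rˣ, ((-a : Rˣ) : Rˣ ⧸ N) = (a : Rˣ ⧸ N) := by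
    intro a
    rw [QuotientGroup.eq]
    right; simp
  have hqe : ∀ a b : Rˣ, (a : Rˣ ⧸ N) = (b : Rˣ ⧸ N) → a = b ∨ a = -b := by
    intro a b h
    rw [QuotientGroup.eq] at h
    rcases h with h | h
    · left; rw [inv_mul_eq_one] at h; exact h
    · right; rw [inv_mul_eq_iff_eq_mul] at h; rw [h]; simp
  obtain ⟨σ, hσ⟩ := perm_pres m (fun i j => (V i j : Rˣ ⧸ N)) (fun i => by simp [hV1])
    (fun i j => by rw [← QuotientGroup.mk_mul, hVsq]; rfl)
    (fun i j => by
      by_cases h : i = j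
      · subst h; rfl
      · rw [hVs i j h, hneg])
    (fun i j k l => by
      by_cases h : i = j
      · subst h; simp [hV1]
      by_cases h' : k = l
      · subst h'; simp [hV1]
      rw [← QuotientGroup.mk_mul, hVc i j k l h h', hneg, QuotientGroup.mk_mul])
  choose u hu using fun g => QuotientGroup.mk_surjective (σ g)
  refine ⟨Rˣ, inferInstance, inferInstance, u, ?_, ?_, ?_⟩
  · intro h
    exact hne (by simpa using congrArg Units.val h)
  · intro g h
    apply hqe
    rw [QuotientGroup.mk_mul, hu, hu, hu, map_mul]
  · have a1 := hqe (u (swap o i₁)) (V o i₁) (by rw [hu, hσ])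
    have a2 := hqe (u (swap i₂ i₃)) (V i₂ i₃) (by rw [hu, hσ])
    have a3 := hVc o i₁ i₂ i₃ h01 h23
    rw [swap_apply_of_ne_of_ne h02.symm h12.symm, swap_apply_of_ne_of_ne h03.symm h13.symm] at a3
    rcases a1 with a1 | a1 <;> rcases a2 with a2 | a2 <;> rw [a1, a2] <;> simp [a3]

open Equiv in
theorem exists_cocycle (m : ℕ) (o i₁ i₂ i₃ : Fin m) (h01 : o ≠ i₁) (h23 : i₂ ≠ i₃) (h02 : o ≠ i₂)
    (h03 : o ≠ i₃) (h12 : i₁ ≠ i₂) (h13 : i₁ ≠ i₃) {A : Type*} [AddCommGroup A] (c : A)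
    (hc : c + c = 0) :
    ∃ f : Perm (Fin m) × Perm (Fin m) → A,
      (∀ g h j, f (g * h, j) + f (g, h) = f (h, j) + f (g, h * j)) ∧
      f (swap o i₁, swap i₂ i₃) - f (swap i₂ i₃, swap o i₁) = c := by
  obtain ⟨U, _, _, u, hne, hu, ha⟩ := exists_spin m o i₁ i₂ i₃ h01 h23 h02 h03 h12 h13
  classical
  have hn : ∀ a : U, a ≠ -a := fun a h => hne (mul_left_cancel (a := a) (by simpa using h))
  let f : Perm (Fin m) × Perm (Fin m) → A := fun x => if u x.1 * u x.2 = u (x.1 * x.2) then 0 else c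
  have f0 : ∀ g h, u g * u h = u (g * h) → f (g, h) = 0 := fun g h e => by simp [f, e]
  have f1 : ∀ g h, u g * u h = -u (g * h) → f (g, h) = c := fun g h e => by
    simp [f, e, (hn _).symm]
  have hcn : c - 0 = c ∧ 0 - c = c := ⟨by simp, by rw [zero_sub]; exact neg_eq_of_add_eq_zero_left hc⟩
  refine ⟨f, ?_, ?_⟩
  · intro g h j
    have as : u g * u h * u j = u g * (u h * u j) := mul_assoc _ _ _
    have as' : g * h * j = g * (h * j) := mul_assoc _ _ _
    rcases hu (g * h) j with e1 | e1 <;> rcases hu g h with e2 | e2 <;>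
      rcases hu h j with e3 | e3 <;> rcases hu g (h * j) with e4 | e4 <;>
      simp only [f0 _ _, f1 _ _, e1, e2, e3, e4] <;>
      rw [e2, e3] at as <;> simp only [neg_mul, mul_neg, e1, e4, neg_neg, as'] at as <;>
      first
      | (simp [hc]; done)
      | exact absurd as (hn _)
      | exact absurd as.symm (hn _)
  · have hcomm : swap o i₁ * swap i₂ i₃ = swap i₂ i₃ * swap o i₁ := by
      rw [Equiv.mul_swap_eq_swap_mul, swap_apply_of_ne_of_ne h02.symm h12.symm,
        swap_apply_of_ne_of_ne h03.symm h13.symm]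
    rcases hu (swap i₂ i₃) (swap o i₁) with e | e
    · rw [f0 _ _ e, f1 _ _ (by rw [ha, e, hcomm]), hcn.1]
    · rw [f1 _ _ e, f0 _ _ (by rw [ha, e, hcomm, neg_neg]), hcn.2]

/-- The underlying type of the central extension attached to a 2-cocycle. -/
@[ext] structure CocycleExt {G A : Type*} (f : G × G → A) where
  fst : A
  snd : G

theorem cocycle_one_left {G A : Type*} [Group G] [AddCommGroup A] {f : G × G → A}
    (hf : ∀ g h j, f (g * h, j) + f (g, h) = f (h, j) + f (g, h * j)) (g : G) :
    f (1, g) = f (1, 1) := by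
  have := hf 1 1 g
  simp only [one_mul] at this
  exact (add_left_cancel this).symm

theorem cocycle_one_right {G A : Type*} [Group G] [AddCommGroup A] {f : G × G → A}
    (hf : ∀ g h j, f (g * h, j) + f (g, h) = f (h, j) + f (g, h * j)) (g : G) :
    f (g, 1) = f (1, 1) := by
  have := hf g 1 1
  simp only [mul_one] at this
  exact add_right_cancel this

/-- The group structure on the extension. -/
@[reducible] def CocycleExt.group {G A : Type*} [Group G] [AddCommGroup A] (f : G × G → A)
    (hf : ∀ g h j, f (g * h, j) + f (g, h) = f (h, j) + f (g, h * j)) : Group (CocycleExt f) :=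
  letI : Mul (CocycleExt f) := ⟨fun x y => ⟨x.1 + y.1 + f (x.2, y.2), x.2 * y.2⟩⟩
  letI : One (CocycleExt f) := ⟨⟨- f (1, 1), 1⟩⟩
  letI : Inv (CocycleExt f) := ⟨fun x => ⟨- x.1 - f (x.2⁻¹, x.2) - f (1, 1), x.2⁻¹⟩⟩
  Group.ofLeftAxioms
    (fun x y z => by
      ext
      · change x.1 + y.1 + f (x.2, y.2) + z.1 + f (x.2 * y.2, z.2) =
          x.1 + (y.1 + z.1 + f (y.2, z.2)) + f (x.2, y.2 * z.2)
        rw [eq_sub_of_add_eq (hf x.2 y.2 z.2)]; abel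
      · exact mul_assoc _ _ _)
    (fun x => by
      ext
      · change - f (1, 1) + x.1 + f (1, x.2) = x.1
        rw [cocycle_one_left hf x.2]; abel
      · exact one_mul _)
    (fun x => by
      ext
      · change - x.1 - f (x.2⁻¹, x.2) - f (1, 1) + x.1 + f (x.2⁻¹, x.2) = - f (1, 1)
        abel
      · exact inv_mul_cancel _)

open Equiv in
theorem coboundary_of_comm (m : ℕ) (o i₁ i₂ i₃ : Fin m) (h01 : o ≠ i₁) (h23 : i₂ ≠ i₃)
    (h02 : o ≠ i₂) (h03 : o ≠ i₃) (h12 : i₁ ≠ i₂) (h13 : i₁ ≠ i₃) {A : Type*} [AddCommGroup A]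
    (hA : ∀ a : A, ∃ b, b + b = a) (f : Perm (Fin m) × Perm (Fin m) → A)
    (hf : ∀ g h j, f (g * h, j) + f (g, h) = f (h, j) + f (g, h * j))
    (h : f (swap o i₁, swap i₂ i₃) - f (swap i₂ i₃, swap o i₁) = 0) :
    ∃ x : Perm (Fin m) → A, ∀ g h, x h - x (g * h) + x g = f (g, h) := by
  letI := CocycleExt.group f hf
  have hmul : ∀ x y : CocycleExt f, x * y = ⟨x.1 + y.1 + f (x.2, y.2), x.2 * y.2⟩ :=
    fun _ _ => rfl
  let p : CocycleExt f →* Perm (Fin m) := ⟨⟨fun x => x.2, rfl⟩, fun _ _ => rfl⟩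
  have hcomm : swap o i₁ * swap i₂ i₃ = swap i₂ i₃ * swap o i₁ := by
    rw [Equiv.mul_swap_eq_swap_mul, swap_apply_of_ne_of_ne h02.symm h12.symm,
      swap_apply_of_ne_of_ne h03.symm h13.symm]
  obtain ⟨σ, hσ⟩ := split_of_comm m p (fun g => ⟨⟨0, g⟩, rfl⟩) (by
      rintro ⟨a, g⟩ hz ⟨b, h⟩
      change g = 1 at hz
      subst hz
      rw [hmul, hmul]
      ext1
      · change a + b + f (1, h) = b + a + f (h, 1)
        rw [cocycle_one_left hf h, cocycle_one_right hf h]; abel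
      · change 1 * h = h * 1
        simp) (by
      rintro ⟨a, g⟩ hz
      change g = 1 at hz
      subst hz
      obtain ⟨b, hb⟩ := hA (a - f (1, 1))
      refine ⟨⟨b, 1⟩, rfl, ?_⟩
      rw [hmul]
      ext1
      · change b + b + f (1, 1) = a
        rw [hb]; abel
      · exact mul_one _) o i₁ i₂ i₃ h01 h23 h02 h03 h12 h13 ⟨0, swap o i₁⟩ ⟨0, swap i₂ i₃⟩ rfl rfl (by
      rw [hmul, hmul]
      ext1
      · change 0 + 0 + f (_, _) = 0 + 0 + f (_, _)
        rw [sub_eq_zero.1 h]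
      · exact hcomm)
  refine ⟨fun g => - (σ g).1, fun g h => ?_⟩
  have e := congrArg CocycleExt.fst (map_mul σ g h)
  have e1 : (σ g).2 = g := hσ g
  have e2 : (σ h).2 = h := hσ h
  rw [hmul] at e
  simp only [e1, e2] at e
  simp only [e]; abel

theorem two_phi {G A : Type*} [Group G] [AddCommGroup A] {f : G × G → A}
    (hf : ∀ g h j, f (g * h, j) + f (g, h) = f (h, j) + f (g, h * j)) (s t : G) (hs : s * s = 1)
    (hst : s * t = t * s) : (f (s, t) - f (t, s)) + (f (s, t) - f (t, s)) = 0 := by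
  have e1 := hf s s t
  have e2 := hf t s s
  have e3 := hf s t s
  rw [hs, cocycle_one_left hf] at e1
  rw [hs, cocycle_one_right hf] at e2
  rw [hst] at e3 e1
  have e1' := eq_sub_of_add_eq' e1.symm
  have e2' := eq_sub_of_add_eq e2
  rw [e1', e2', ← sub_eq_zero] at e3
  rw [← e3]; abel

theorem qz_half : ∃ c : AddCircle (1 : ℚ), c ≠ 0 ∧ c + c = 0 ∧
    ∀ x : AddCircle (1 : ℚ), x + x = 0 → x = 0 ∨ x = c := by
  have hz : ∀ q : ℚ, ((q : AddCircle (1 : ℚ)) = 0 ↔ ∃ n : ℤ, (n : ℚ) = q) := by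
    intro q
    rw [AddCircle.coe_eq_zero_iff]
    simp
  refine ⟨((1 / 2 : ℚ) : AddCircle (1 : ℚ)), ?_, ?_, ?_⟩
  · rw [Ne, hz]
    rintro ⟨n, hn⟩
    have : (2 * n : ℚ) = 1 := by rw [hn]; norm_num
    have : 2 * n = 1 := by exact_mod_cast this
    omega
  · rw [← AddCircle.coe_add, hz]
    exact ⟨1, by norm_num⟩
  · intro x hx
    induction x using QuotientAddGroup.induction_on with
    | H q =>
      change ((q : ℚ) : AddCircle (1 : ℚ)) + ((q : ℚ) : AddCircle (1 : ℚ)) = 0 at hx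
      change ((q : ℚ) : AddCircle (1 : ℚ)) = 0 ∨ ((q : ℚ) : AddCircle (1 : ℚ)) = _
      rw [← AddCircle.coe_add, hz] at hx
      obtain ⟨n, hn⟩ := hx
      rw [← sub_eq_zero (b := ((1 / 2 : ℚ) : AddCircle (1 : ℚ))), ← AddCircle.coe_sub, hz, hz]
      rcases Int.even_or_odd' n with ⟨k, rfl | rfl⟩
      · left; exact ⟨k, by push_cast at hn; linarith⟩
      · right; exact ⟨k, by push_cast at hn; linarith⟩

theorem qz_div (a : AddCircle (1 : ℚ)) : ∃ b, b + b = a := by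
  induction a using QuotientAddGroup.induction_on with
  | H q =>
    refine ⟨((q / 2 : ℚ) : AddCircle (1 : ℚ)), ?_⟩
    rw [← AddCircle.coe_add, add_halves]

/-- For `m ≥ 4`, the second group cohomology `H²(S_m; ℚ/ℤ)` of the symmetric group
`S_m` with coefficients in `ℚ/ℤ` (with trivial action) is isomorphic to `ℤ/2`. -/
theorem h2_symm_qmodz (m : ℕ) (hm : 4 ≤ m) :
    Nonempty
      ((groupCohomology
          (Rep.trivial ℤ (Equiv.Perm (Fin m)) (AddCircle (1 : ℚ))) 2) ≃+ ZMod 2) := by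
  obtain ⟨o, i₁, i₂, i₃, h01, h23, h02, h03, h12, h13⟩ : ∃ o i₁ i₂ i₃ : Fin m,
      o ≠ i₁ ∧ i₂ ≠ i₃ ∧ o ≠ i₂ ∧ o ≠ i₃ ∧ i₁ ≠ i₂ ∧ i₁ ≠ i₃ :=
    ⟨⟨0, by omega⟩, ⟨1, by omega⟩, ⟨2, by omega⟩, ⟨3, by omega⟩, by simp, by simp, by simp,
      by simp, by simp, by simp⟩
  obtain ⟨c, hc0, hcc, hc⟩ := qz_half
  obtain ⟨f₀, hf₀, hφ₀⟩ := exists_cocycle m o i₁ i₂ i₃ h01 h23 h02 h03 h12 h13 c hcc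
  let M := Rep.trivial ℤ (Equiv.Perm (Fin m)) (AddCircle (1 : ℚ))
  let s := Equiv.swap o i₁
  let t := Equiv.swap i₂ i₃
  have hcomm : s * t = t * s := by
    simp only [s, t]
    rw [Equiv.mul_swap_eq_swap_mul, Equiv.swap_apply_of_ne_of_ne h02.symm h12.symm,
      Equiv.swap_apply_of_ne_of_ne h03.symm h13.symm]
  have hss : s * s = 1 := Equiv.swap_mul_self _ _
  have hcoc : ∀ f : groupCohomology.cocycles₂ M, ∀ g h j,
      (f (g * h, j) : AddCircle (1 : ℚ)) + f (g, h) = f (h, j) + f (g, h * j) := by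
    intro f
    exact (groupCohomology.mem_cocycles₂_iff (A := M) f.1).1 f.2
  let F₀ : groupCohomology.cocycles₂ M :=
    ⟨f₀, (groupCohomology.mem_cocycles₂_iff (A := M) f₀).2 hf₀⟩
  have hcob : ∀ f : groupCohomology.cocycles₂ M,
      groupCohomology.H2π M f = 0 ↔ (f (s, t) : AddCircle (1 : ℚ)) - f (t, s) = 0 := by
    intro f
    rw [groupCohomology.H2π_eq_zero_iff]
    constructor
    · rintro ⟨x, hx⟩
      have e1 : (x t : AddCircle (1 : ℚ)) - x (s * t) + x s = f (s, t) := congrFun hx (s, t)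
      have e2 : (x s : AddCircle (1 : ℚ)) - x (t * s) + x t = f (t, s) := congrFun hx (t, s)
      rw [← e1, ← e2, hcomm]; abel
    · intro h
      obtain ⟨x, hx⟩ := coboundary_of_comm m o i₁ i₂ i₃ h01 h23 h02 h03 h12 h13 qz_div
        (fun x => f x) (hcoc f) h
      exact ⟨x, funext fun y => hx y.1 y.2⟩
  have hne : groupCohomology.H2π M F₀ ≠ 0 := by
    rw [Ne, hcob]
    change ¬ (f₀ _ - f₀ _ = 0)
    rw [hφ₀]; exact hc0
  have htwo : ∀ x : groupCohomology M 2, x = 0 ∨ x = groupCohomology.H2π M F₀ := by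
    intro x
    induction x using groupCohomology.H2_induction_on with
    | h f =>
      rcases hc _ (two_phi (hcoc f) s t hss hcomm) with h | h
      · left; exact (hcob f).2 h
      · right
        rw [← sub_eq_zero, ← map_sub, hcob]
        change (f (s, t) - f₀ (s, t) : AddCircle (1 : ℚ)) - (f (t, s) - f₀ (t, s)) = 0
        rw [sub_sub_sub_comm, h, hφ₀, sub_self]
  have hcard : Nat.card (groupCohomology M 2) = 2 := by
    rw [Nat.card_eq_two_iff]
    refine ⟨0, groupCohomology.H2π M F₀, hne.symm, ?_⟩
    ext x
    simpa using htwo x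
  haveI : Fact (Nat.Prime 2) := ⟨Nat.prime_two⟩
  exact ⟨addEquivOfPrimeCardEq hcard (Nat.card_zmod 2)⟩
end

section
/- For every m ≥ 4, the second group cohomology H²(S_m; ℤ/2) of the symmetric group S_m with coefficients in ℤ/2 with trivial action is isomorphic, as an abelian group, to (ℤ/2) × (ℤ/2). -/
namespace H2Symm
open Equiv

/-- Elements of `X` lying over a transposition of two points `< k`. -/
def Xk {E : Type*} [Group E] {m : ℕ} (π : E →* Perm (Fin m)) (X : Set E) (k : ℕ) : Set E :=
  {x | x ∈ X ∧ ∃ a b : Fin m, a ≠ b ∧ a.val < k ∧ b.val < k ∧ π x = swap a b}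

lemma conj_swap' {α : Type*} [DecidableEq α] (g : Perm α) (a b : α) :
    g * swap a b * g⁻¹ = swap (g a) (g b) := by
  rw [Equiv.mul_swap_eq_swap_mul, mul_assoc, mul_inv_cancel, mul_one]

lemma decomp {E : Type*} [Group E] {m : ℕ} (π : E →* Perm (Fin m)) (X : Set E)
    (hconj : ∀ e x, x ∈ X → e * x * e⁻¹ ∈ X) (hsq : ∀ x ∈ X, x * x = 1)
    (hinj : ∀ x ∈ X, ∀ y ∈ X, π x = π y → x = y)
    (k : ℕ) (x : E) (hx : x ∈ Subgroup.closure (Xk π X (k + 1))) :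
    x ∈ Subgroup.closure (Xk π X k) ∨ ∃ d ∈ Subgroup.closure (Xk π X k), ∃ y ∈ X,
      ∃ i kk : Fin m, i.val < k ∧ kk.val = k ∧ π y = swap i kk ∧ x = d * y := by
  have hpre : ∀ w ∈ Xk π X (k + 1), w ∈ Xk π X k ∨
      (w ∈ X ∧ ∃ i kk : Fin m, i.val < k ∧ kk.val = k ∧ π w = swap i kk) := by
    rintro w ⟨hwX, a, b, hab, ha, hb, hw⟩
    have hab' : a.val ≠ b.val := fun h => hab (Fin.ext h)
    by_cases hak : a.val = k
    · right
      exact ⟨hwX, b, a, by omega, hak, by rw [hw, swap_comm]⟩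
    · by_cases hbk : b.val = k
      · right
        exact ⟨hwX, a, b, by omega, hbk, hw⟩
      · left
        exact ⟨hwX, a, b, hab, by omega, by omega, hw⟩
  have step : ∀ x, (x ∈ Subgroup.closure (Xk π X k) ∨ ∃ d ∈ Subgroup.closure (Xk π X k), ∃ y ∈ X,
      ∃ i kk : Fin m, i.val < k ∧ kk.val = k ∧ π y = swap i kk ∧ x = d * y) →
      ∀ w ∈ Xk π X (k + 1),
      (x * w ∈ Subgroup.closure (Xk π X k) ∨ ∃ d ∈ Subgroup.closure (Xk π X k), ∃ y ∈ X,
      ∃ i kk : Fin m, i.val < k ∧ kk.val = k ∧ π y = swap i kk ∧ x * w = d * y) := by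
    rintro x (hx | ⟨d, hd, y, hy, i, kk, hi, hkk, hπ, rfl⟩) w hw
    · rcases hpre w hw with h | ⟨hwX, i, kk, hi, hkk, hπ⟩
      · left; exact mul_mem hx (Subgroup.subset_closure h)
      · right; exact ⟨x, hx, w, hwX, i, kk, hi, hkk, hπ, rfl⟩
    · rcases hpre w hw with h | ⟨hwX, j, kk', hj, hkk', hπ'⟩
      · right
        obtain ⟨hwX, a, b, hab, ha, hb, hπw⟩ := id h
        refine ⟨d * w, mul_mem hd (Subgroup.subset_closure h), w⁻¹ * y * w, ?_,
          swap a b i, kk, ?_, hkk, ?_, by group⟩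
        · simpa using hconj w⁻¹ y hy
        · rw [swap_apply_def]; split_ifs <;> assumption
        · have := conj_swap' (swap a b) i kk
          rw [swap_apply_of_ne_of_ne (a := a) (b := b) (x := kk)] at this
          · rw [← this]; simp [hπ, hπw]
          · rintro rfl; omega
          · rintro rfl; omega
      · obtain rfl : kk = kk' := Fin.ext (by omega)
        by_cases hij : j = i
        · subst hij
          left
          have : w = y := hinj _ hwX _ hy (by rw [hπ, hπ'])
          rw [this, mul_assoc, hsq y hy, mul_one]; exact hd
        · right
          refine ⟨d * (y * w * y⁻¹), mul_mem hd (Subgroup.subset_closure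
            ⟨hconj _ _ hwX, j, i, hij, hj, hi, ?_⟩), y, hy, i, kk, hi, hkk, hπ, by group⟩
          have := conj_swap' (swap i kk) j kk
          rw [swap_apply_right, swap_apply_of_ne_of_ne (a := i) (b := kk) (x := j) hij] at this
          · rw [← this]; simp [hπ, hπ']
          · rintro rfl; omega
  induction hx using Subgroup.closure_induction_right with
  | one => left; exact one_mem _
  | mul_right x hx y hy ih => exact step x ih y hy
  | mul_inv_cancel x hx y hy ih =>
    have : y⁻¹ = y := inv_eq_of_mul_eq_one_left (hsq y hy.1)
    rw [this]; exact step x ih y hy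

lemma closure_inj {E : Type*} [Group E] {m : ℕ} (π : E →* Perm (Fin m)) (X : Set E)
    (hconj : ∀ e x, x ∈ X → e * x * e⁻¹ ∈ X) (hsq : ∀ x ∈ X, x * x = 1)
    (hinj : ∀ x ∈ X, ∀ y ∈ X, π x = π y → x = y)
    (k : ℕ) : ∀ x ∈ Subgroup.closure (Xk π X k), π x = 1 → x = 1 := by
  induction k with
  | zero =>
    intro x hx _
    have : Xk π X 0 = ∅ := by
      ext x; simp [Xk]
    rw [this, Subgroup.closure_empty] at hx
    exact hx
  | succ k ih =>
    intro x hx h1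
    rcases decomp π X hconj hsq hinj k x hx with h | ⟨d, hd, y, hy, i, kk, hi, hkk, hπ, rfl⟩
    · exact ih x h h1
    · exfalso
      have hfix : ∀ e ∈ Subgroup.closure (Xk π X k), π e kk = kk := by
        intro e he
        induction he using Subgroup.closure_induction with
        | mem x hx =>
          obtain ⟨_, a, b, hab, ha, hb, h⟩ := hx
          rw [h, swap_apply_of_ne_of_ne]
          · rintro rfl; omega
          · rintro rfl; omega
        | one => simp
        | mul x y _ _ hx hy => simp [hx, hy]
        | inv x _ hx => rw [map_inv, Perm.inv_eq_iff_eq, hx]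
      have h2 : π d (π y i) = i := by
        have := congrArg (fun g : Perm (Fin m) => g i) h1
        simpa using this
      rw [hπ, swap_apply_left, hfix d hd] at h2
      rw [h2] at hkk; omega

/-- Splitting criterion for central extensions of the symmetric group. -/
theorem splits {E : Type*} [Group E] {m : ℕ} (π : E →* Perm (Fin m))
    (hπ : Function.Surjective π) (hcent : ∀ e, π e = 1 → ∀ x, e * x = x * e)
    (p0 p1 p2 p3 : Fin m) (h01 : p0 ≠ p1) (h02 : p0 ≠ p2) (h03 : p0 ≠ p3) (h12 : p1 ≠ p2)
    (h13 : p1 ≠ p3) (h23 : p2 ≠ p3)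
    (t t' : E) (ht : π t = swap p0 p1) (ht' : π t' = swap p2 p3) (htt : t * t = 1)
    (hcomm : t * t' = t' * t) : ∃ σ : Perm (Fin m) →* E, ∀ g, π (σ g) = g := by
  classical
  -- elements with same image differ by a central element
  have hker : ∀ e e', π e = π e' → ∃ k, π k = 1 ∧ e = k * e' := fun e e' h =>
    ⟨e * e'⁻¹, by simp [h], by group⟩
  have hcongr : ∀ e e', π e = π e' → e * t = t * e → e' * t = t * e' := by
    intro e e' h he
    obtain ⟨k, hk, rfl⟩ := hker e' e h.symm
    rw [mul_assoc, he, ← mul_assoc, hcent k hk, mul_assoc]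
  -- swaps of other points commute with t
  have hswap : ∀ a b : Fin m, a ≠ b → a ≠ p0 → a ≠ p1 → b ≠ p0 → b ≠ p1 →
      ∀ e, π e = swap a b → e * t = t * e := by
    intro a b hab ha0 ha1 hb0 hb1 e he
    obtain ⟨g, g0, g1, g2, g3⟩ : ∃ g : Perm (Fin m), g p0 = p0 ∧ g p1 = p1 ∧ g p2 = a ∧
        g p3 = b := by
      have q0 : swap p2 a p0 = p0 := swap_apply_of_ne_of_ne h02 ha0.symm
      have q1 : swap p2 a p1 = p1 := swap_apply_of_ne_of_ne h12 ha1.symm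
      have q2 : swap p2 a p2 = a := swap_apply_left _ _
      refine ⟨swap (swap p2 a p3) b * swap p2 a, ?_, ?_, ?_, ?_⟩
      · rw [Perm.mul_apply, q0]
        refine swap_apply_of_ne_of_ne ?_ hb0.symm
        intro h; rw [← q0] at h
        exact h03 ((swap p2 a).injective (by rw [← h, q0]))
      · rw [Perm.mul_apply, q1]
        refine swap_apply_of_ne_of_ne ?_ hb1.symm
        intro h; rw [← q1] at h
        exact h13 ((swap p2 a).injective (by rw [← h, q1]))
      · rw [Perm.mul_apply, q2]
        refine swap_apply_of_ne_of_ne ?_ hab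
        intro h
        exact h23 ((swap p2 a).injective (by rw [q2, ← h]))
      · rw [Perm.mul_apply, swap_apply_left]
    obtain ⟨γ, rfl⟩ := hπ g
    obtain ⟨k, hk, hk'⟩ := hker (γ * t * γ⁻¹) t (by
      rw [map_mul, map_mul, map_inv, ht, conj_swap', g0, g1])
    refine hcongr (γ * t' * γ⁻¹) e (by
      rw [map_mul, map_mul, map_inv, ht', conj_swap', g2, g3, he]) ?_
    have h1 : t = k⁻¹ * (γ * t * γ⁻¹) := by rw [hk']; group
    have hk1 : ∀ x, k⁻¹ * x = x * k⁻¹ := hcent _ (by simp [hk])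
    have h2 : (γ * t' * γ⁻¹) * (γ * t * γ⁻¹) = (γ * t * γ⁻¹) * (γ * t' * γ⁻¹) := by
      have : γ * (t' * t) * γ⁻¹ = γ * (t * t') * γ⁻¹ := by rw [hcomm]
      simpa [mul_assoc] using this
    calc γ * t' * γ⁻¹ * t = γ * t' * γ⁻¹ * (k⁻¹ * (γ * t * γ⁻¹)) := by rw [← h1]
      _ = k⁻¹ * ((γ * t' * γ⁻¹) * (γ * t * γ⁻¹)) := by
        rw [← mul_assoc, ← hk1, mul_assoc]
      _ = k⁻¹ * (γ * t * γ⁻¹) * (γ * t' * γ⁻¹) := by rw [h2, mul_assoc k⁻¹]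
      _ = t * (γ * t' * γ⁻¹) := by rw [← h1]
  -- everything fixing p0, p1 commutes with t
  have hfix : ∀ c : Perm {x : Fin m // x ≠ p0 ∧ x ≠ p1},
      ∀ e, π e = Perm.ofSubtype c → e * t = t * e := by
    intro c
    induction c using Perm.swap_induction_on with
    | one =>
      intro e he
      exact hcent e (by rw [he, map_one]) t
    | swap_mul f x y hxy ih =>
      intro e he
      obtain ⟨u, hu⟩ := hπ (swap x.1 y.1)
      obtain ⟨v, hv⟩ := hπ (Perm.ofSubtype f)
      have hu' := hswap x.1 y.1 (fun h => hxy (Subtype.ext h)) x.2.1 x.2.2 y.2.1 y.2.2 u hu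
      have hv' := ih v hv
      refine hcongr (u * v) e ?_ ?_
      · rw [he, map_mul, map_mul, hu, hv, Perm.ofSubtype_swap_eq]
      · rw [mul_assoc, hv', ← mul_assoc, hu', mul_assoc]
  have hfix' : ∀ e, π e p0 = p0 → π e p1 = p1 → e * t = t * e := by
    intro e h0 h1
    have hp : ∀ x, (x ≠ p0 ∧ x ≠ p1) ↔ (π e x ≠ p0 ∧ π e x ≠ p1) := by
      intro x
      have a0 : π e x = p0 ↔ x = p0 := by
        rw [← (π e).injective.eq_iff (a := x), h0]
      have a1 : π e x = p1 ↔ x = p1 := by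
        rw [← (π e).injective.eq_iff (a := x), h1]
      simp [a0, a1]
    refine hfix ((π e).subtypePerm (fun x => (hp x).symm)) e ?_
    rw [Perm.ofSubtype_subtypePerm]
    rintro x hx
    refine ⟨?_, ?_⟩
    · rintro rfl; exact hx h0
    · rintro rfl; exact hx h1
  have hcen : ∀ e, swap (π e p0) (π e p1) = swap p0 p1 → e * t = t * e := by
    intro e he
    have hc : (π e p0 = p0 ∧ π e p1 = p1) ∨ (π e p0 = p1 ∧ π e p1 = p0) := by
      have hne : π e p0 ≠ π e p1 := fun h => h01 ((π e).injective h)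
      have e0 := congrArg (fun g : Perm (Fin m) => g p0) he
      have e1 := congrArg (fun g : Perm (Fin m) => g p1) he
      simp only [swap_apply_left, swap_apply_right] at e0 e1
      rw [swap_apply_def] at e0 e1
      grind
    rcases hc with ⟨h0, h1⟩ | ⟨h0, h1⟩
    · exact hfix' e h0 h1
    · have := hfix' (t * e) (by simp [ht, h0]) (by simp [ht, h1])
      rw [mul_assoc] at this
      exact mul_left_cancel this
  let X : Set E := {x | ∃ e, x = e * t * e⁻¹}
  have hconj : ∀ e x, x ∈ X → e * x * e⁻¹ ∈ X := by
    rintro e x ⟨e', rfl⟩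
    exact ⟨e * e', by group⟩
  have hsq : ∀ x ∈ X, x * x = 1 := by
    rintro x ⟨e, rfl⟩
    have : e * (t * t) * e⁻¹ = 1 := by simp [htt]
    simpa [mul_assoc] using this
  have hinj : ∀ x ∈ X, ∀ y ∈ X, π x = π y → x = y := by
    rintro x ⟨e, rfl⟩ y ⟨e', rfl⟩ h
    have h1 := hcen (e'⁻¹ * e) (by
      rw [← conj_swap', ← ht]
      simp only [map_mul, map_inv] at h ⊢
      have : (π e')⁻¹ * (π e * π t * (π e)⁻¹) * π e' = (π e')⁻¹ * (π e' * π t * (π e')⁻¹) * π e' := by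
        rw [h]
      simpa [mul_assoc] using this)
    have : e' * (e'⁻¹ * e * t) * e⁻¹ = e' * (t * (e'⁻¹ * e)) * e⁻¹ := by rw [h1]
    simpa [mul_assoc] using this
  have hswaps : ∀ x ∈ X, ∃ a b : Fin m, a ≠ b ∧ π x = swap a b := by
    rintro x ⟨e, rfl⟩
    refine ⟨π e p0, π e p1, fun h => h01 ((π e).injective h), ?_⟩
    rw [← conj_swap', ← ht]; simp
  have hXm : Xk π X m = X := by
    ext x
    refine ⟨fun h => h.1, fun h => ⟨h, ?_⟩⟩
    obtain ⟨a, b, hab, hx⟩ := hswaps x h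
    exact ⟨a, b, hab, a.2, b.2, hx⟩
  have hD := closure_inj π X hconj hsq hinj m
  rw [hXm] at hD
  let φ : Subgroup.closure X →* Perm (Fin m) := π.comp (Subgroup.closure X).subtype
  have hφi : Function.Injective φ := by
    rw [injective_iff_map_eq_one]
    rintro ⟨x, hx⟩ h
    exact Subtype.ext (hD x hx h)
  have hφs : Function.Surjective φ := by
    rw [← MonoidHom.range_eq_top, eq_top_iff, ← Perm.closure_isSwap, Subgroup.closure_le]
    rintro s ⟨a, b, hab, rfl⟩
    obtain ⟨g, hg⟩ := isConj_iff.1 (Perm.isConj_swap h01 hab)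
    obtain ⟨e, rfl⟩ := hπ g
    refine ⟨⟨e * t * e⁻¹, Subgroup.subset_closure ⟨e, rfl⟩⟩, ?_⟩
    rw [← hg, ← ht]; simp [φ]
  let ψ := MulEquiv.ofBijective φ ⟨hφi, hφs⟩
  refine ⟨(Subgroup.closure X).subtype.comp ψ.symm.toMonoidHom, fun g => ?_⟩
  exact ψ.apply_symm_apply g


/-- The central extension attached to a normalised 2-cocycle. -/
@[ext] structure Ext {G : Type*} (f : G → G → ZMod 2) where
  c : ZMod 2
  g : G

/-- Group structure on the extension. -/
@[reducible] def extGroup {G : Type*} [Group G] (f : G → G → ZMod 2)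
    (hf : ∀ g h k, f (g * h) k + f g h = f h k + f g (h * k))
    (h1 : ∀ g, f 1 g = 0) : Group (Ext f) :=
  letI : Mul (Ext f) := ⟨fun x y => ⟨x.c + y.c + f x.g y.g, x.g * y.g⟩⟩
  letI : One (Ext f) := ⟨⟨0, 1⟩⟩
  letI : Inv (Ext f) := ⟨fun x => ⟨-(x.c + f x.g⁻¹ x.g), x.g⁻¹⟩⟩
  Group.ofLeftAxioms
    (by
      rintro ⟨a, g⟩ ⟨b, h⟩ ⟨c, k⟩
      apply Ext.ext
      · change a + b + f g h + c + f (g * h) k = a + (b + c + f h k) + f g (h * k)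
        linear_combination hf g h k
      · exact mul_assoc _ _ _)
    (by
      rintro ⟨a, g⟩
      apply Ext.ext
      · change 0 + a + f 1 g = a
        rw [h1]; ring
      · exact one_mul _)
    (by
      rintro ⟨a, g⟩
      apply Ext.ext
      · change -(a + f g⁻¹ g) + a + f g⁻¹ g = 0
        ring
      · exact inv_mul_cancel _)

theorem isCobound {m : ℕ} (f : Perm (Fin m) → Perm (Fin m) → ZMod 2)
    (hf : ∀ g h k, f (g * h) k + f g h = f h k + f g (h * k))
    (h1 : ∀ g, f 1 g = 0) (h2 : ∀ g, f g 1 = 0)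
    (p0 p1 p2 p3 : Fin m) (h01 : p0 ≠ p1) (h02 : p0 ≠ p2) (h03 : p0 ≠ p3) (h12 : p1 ≠ p2)
    (h13 : p1 ≠ p3) (h23 : p2 ≠ p3)
    (hα : f (swap p0 p1) (swap p0 p1) = 0)
    (hβ : f (swap p0 p1) (swap p2 p3) = f (swap p2 p3) (swap p0 p1)) :
    ∃ φ : Perm (Fin m) → ZMod 2, ∀ g h, f g h = φ h - φ (g * h) + φ g := by
  let _ := extGroup f hf h1
  have hmul : ∀ x y : Ext f, x * y = ⟨x.c + y.c + f x.g y.g, x.g * y.g⟩ := fun _ _ => rfl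
  have hone : (1 : Ext f) = ⟨0, 1⟩ := rfl
  let π : Ext f →* Perm (Fin m) := ⟨⟨fun x => x.g, rfl⟩, fun _ _ => rfl⟩
  have hπ : ∀ x, π x = x.g := fun _ => rfl
  obtain ⟨σ, hσ⟩ := splits π (fun g => ⟨⟨0, g⟩, rfl⟩)
    (by
      rintro ⟨a, g⟩ h ⟨b, k⟩
      have h : g = 1 := h
      subst h
      simp [hmul, h1, h2, add_comm])
    p0 p1 p2 p3 h01 h02 h03 h12 h13 h23 ⟨0, swap p0 p1⟩ ⟨0, swap p2 p3⟩ rfl rfl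
    (by simp [hmul, hone, hα])
    (by
      have hd : swap p0 p1 * swap p2 p3 = swap p2 p3 * swap p0 p1 := by
        have := conj_swap' (swap p0 p1) p2 p3
        rw [swap_apply_of_ne_of_ne h02.symm h12.symm, swap_apply_of_ne_of_ne h03.symm h13.symm,
          mul_inv_eq_iff_eq_mul] at this
        exact this
      simp [hmul, hβ, hd])
  refine ⟨fun g => - (σ g).c, fun g h => ?_⟩
  have := congrArg Ext.c (map_mul σ g h)
  have e1 : (σ g).g = g := hσ g
  have e2 : (σ h).g = h := hσ h
  rw [hmul] at this
  simp only [e1, e2] at this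
  simp only [this]; ring

/-! ### The explicit cocycle -/

/-- `1` if the proposition holds, `0` otherwise. -/
noncomputable def ind (p : Prop) : ZMod 2 := by classical exact if p then 1 else 0

/-- action of a permutation on unordered pairs -/
def act {m : ℕ} (g : Perm (Fin m)) (p : Sym2 (Fin m)) : Sym2 (Fin m) :=
  p.map (g⁻¹ : Perm (Fin m))

lemma act_mk {m : ℕ} (g : Perm (Fin m)) (a b : Fin m) : act g s(a, b) = s(g⁻¹ a, g⁻¹ b) := rfl

lemma act_inj {m : ℕ} (g : Perm (Fin m)) : Function.Injective (act g) :=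
  Sym2.map.injective (g⁻¹ : Perm (Fin m)).injective

lemma act_mul {m : ℕ} (g h : Perm (Fin m)) (p : Sym2 (Fin m)) :
    act (g * h) p = act h (act g p) := by
  induction p using Sym2.ind with
  | _ a b => simp [act_mk]

/-- inversion function: does `g⁻¹` change the order of the pair? -/
noncomputable def inv1 {m : ℕ} (g : Perm (Fin m)) : Sym2 (Fin m) → ZMod 2 :=
  Sym2.lift ⟨fun a b => ind ((a < b ∧ g⁻¹ b < g⁻¹ a) ∨ (b < a ∧ g⁻¹ a < g⁻¹ b)), by
    intro a b; simp only [or_comm]⟩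

lemma two (x : ZMod 2) : x + x = 0 := CharTwo.add_self_eq_zero x

lemma inv1_mul {m : ℕ} (g h : Perm (Fin m)) (p : Sym2 (Fin m)) :
    inv1 (g * h) p = inv1 g p + inv1 h (act g p) := by
  induction p using Sym2.ind with
  | _ a b =>
  simp only [inv1, Sym2.lift_mk, act_mk, mul_inv_rev, Perm.mul_apply, ind]
  rcases eq_or_ne a b with rfl | hab
  · simp
  have h1 : g⁻¹ a ≠ g⁻¹ b := fun h => hab (g⁻¹.injective h)
  have h2 : h⁻¹ (g⁻¹ a) ≠ h⁻¹ (g⁻¹ b) := fun h' => h1 (h⁻¹.injective h')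
  rcases lt_or_gt_of_ne hab with h3 | h3 <;> rcases lt_or_gt_of_ne h1 with h4 | h4 <;>
    rcases lt_or_gt_of_ne h2 with h5 | h5 <;>
    simp only [h3, h4, h5, two, not_lt_of_gt h3, not_lt_of_gt h4, not_lt_of_gt h5, and_true,
      and_false, or_true, or_false, if_true, if_false, add_zero, zero_add]

/-- an arbitrary order on unordered pairs -/
noncomputable def mu {m : ℕ} (p q : Sym2 (Fin m)) : ZMod 2 :=
  ind (Fintype.equivFin _ p < Fintype.equivFin _ q)

lemma mu_swap {m : ℕ} (p q : Sym2 (Fin m)) (h : p ≠ q) : mu q p = 1 + mu p q := by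
  have h' : Fintype.equivFin _ p ≠ Fintype.equivFin _ q :=
    fun e => h ((Fintype.equivFin _).injective e)
  unfold mu ind
  rcases lt_or_gt_of_ne h' with h3 | h3 <;> simp [h3, not_lt_of_gt h3, two]

/-- local contribution -/
noncomputable def loc {m : ℕ} (g h : Perm (Fin m)) (p q : Sym2 (Fin m)) : ZMod 2 :=
  if p = q then 0 else
    mu p q * (inv1 g p * inv1 h (act g q)) + (1 + mu p q) * (inv1 g q * inv1 h (act g p))
    + (mu p q + mu (act g p) (act g q)) * (inv1 h (act g p) * inv1 h (act g q))

lemma loc_symm {m : ℕ} (g h : Perm (Fin m)) (p q : Sym2 (Fin m)) : loc g h p q = loc g h q p := by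
  unfold loc
  rcases eq_or_ne p q with rfl | hpq
  · rfl
  rw [if_neg hpq, if_neg hpq.symm, mu_swap p q hpq,
    mu_swap (act g p) (act g q) (fun h => hpq (act_inj _ h))]
  linear_combination - (inv1 g p * inv1 h (act g q) + inv1 h (act g p) * inv1 h (act g q)) *
    two 1

lemma loc_cocycle {m : ℕ} (g h k : Perm (Fin m)) (p q : Sym2 (Fin m)) :
    loc (g * h) k p q + loc g h p q = loc h k (act g p) (act g q) + loc g (h * k) p q := by
  unfold loc
  rcases eq_or_ne p q with rfl | hpq
  · simp
  rw [if_neg hpq, if_neg hpq, if_neg hpq, if_neg (fun h => hpq (act_inj _ h))]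
  simp only [inv1_mul, act_mul]
  generalize inv1 g p = a1
  generalize inv1 g q = a2
  generalize inv1 h (act g p) = b1
  generalize inv1 h (act g q) = b2
  generalize inv1 k (act h (act g p)) = c1
  generalize inv1 k (act h (act g q)) = c2
  generalize mu p q = u
  generalize mu (act g p) (act g q) = v
  generalize mu (act h (act g p)) (act h (act g q)) = w
  rw [← sub_eq_zero]
  have h2 : (2 : ZMod 2) = 0 := rfl
  ring_nf
  simp [h2]

/-- the cocycle -/
noncomputable def coc {m : ℕ} (g h : Perm (Fin m)) : ZMod 2 :=
  ∑ τ : Sym2 (Sym2 (Fin m)), Sym2.lift ⟨loc g h, loc_symm g h⟩ τ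

lemma coc_cocycle {m : ℕ} (g h k : Perm (Fin m)) :
    coc (g * h) k + coc g h = coc h k + coc g (h * k) := by
  have hbij : Function.Bijective (Sym2.map (act g)) :=
    Finite.injective_iff_bijective.1
      (Sym2.map.injective (act_inj g))
  have : (coc h k : ZMod 2) = ∑ τ : Sym2 (Sym2 (Fin m)),
      Sym2.lift ⟨loc h k, loc_symm h k⟩ (Sym2.map (act g) τ) :=
    (Function.Bijective.sum_comp hbij _).symm
  rw [this]
  unfold coc
  rw [← Finset.sum_add_distrib, ← Finset.sum_add_distrib]
  refine Finset.sum_congr rfl fun τ _ => ?_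
  induction τ using Sym2.ind with
  | _ p q =>
  simp only [Sym2.lift_mk, Sym2.map_mk]
  exact loc_cocycle g h k p q


lemma inv1_swap {m : ℕ} (a b : Fin m) (hab : b.val = a.val + 1) (p : Sym2 (Fin m)) :
    inv1 (swap a b) p = if p = s(a, b) then 1 else 0 := by
  induction p using Sym2.ind with
  | _ x y =>
  simp only [inv1, Sym2.lift_mk, swap_inv, ind]
  have key : ((x < y ∧ swap a b y < swap a b x) ∨ (y < x ∧ swap a b x < swap a b y)) ↔
      s(x, y) = s(a, b) := by
    simp only [swap_apply_def, Sym2.eq_iff, Fin.lt_def, Fin.ext_iff]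
    split_ifs <;> omega
  simp only [key]

lemma coc_swap {m : ℕ} (a b c d : Fin m) (hab : b.val = a.val + 1) (hcd : d.val = c.val + 1)
    (hac : a ≠ c) (had : a ≠ d) (hbc : b ≠ c) (hbd : b ≠ d) :
    coc (swap a b) (swap c d) = mu s(a, b) s(c, d) := by
  have hB : act (swap a b) s(c, d) = s(c, d) := by
    rw [act_mk, swap_inv, swap_apply_of_ne_of_ne hac.symm hbc.symm,
      swap_apply_of_ne_of_ne had.symm hbd.symm]
  have hB' : ∀ q, act (swap a b) q = s(c, d) ↔ q = s(c, d) := by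
    intro q
    rw [← (act_inj (swap a b)).eq_iff (a := q), hB]
  have hAB : s(a, b) ≠ s(c, d) := by
    rw [Ne, Sym2.eq_iff]; tauto
  unfold coc
  rw [Finset.sum_eq_single s(s(a, b), s(c, d))]
  · simp only [Sym2.lift_mk, loc, inv1_swap a b hab, inv1_swap c d hcd, hB']
    simp [hAB, hAB.symm]
  · intro τ _ hτ
    induction τ using Sym2.ind with
    | _ p q =>
    simp only [Sym2.lift_mk, loc, inv1_swap a b hab, inv1_swap c d hcd, hB']
    rw [Ne, Sym2.eq_iff] at hτ
    split_ifs <;> simp_all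
  · simp

/-- the sign with values in `ZMod 2` -/
def eps {m : ℕ} (g : Perm (Fin m)) : ZMod 2 := if Perm.sign g = 1 then 0 else 1

lemma eps_mul {m : ℕ} (g h : Perm (Fin m)) : eps (g * h) = eps g + eps h := by
  unfold eps
  rw [map_mul]
  rcases Int.units_eq_one_or (Perm.sign g) with h1 | h1 <;>
    rcases Int.units_eq_one_or (Perm.sign h) with h2 | h2 <;> rw [h1, h2] <;> decide

open groupCohomology in
theorem main (m : ℕ) (hm : 4 ≤ m) :
    Nonempty
      ((groupCohomology
          (Rep.trivial ℤ (Equiv.Perm (Fin m)) (ZMod 2)) 2) ≃+ (ZMod 2 × ZMod 2)) := by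
  set A := Rep.trivial ℤ (Equiv.Perm (Fin m)) (ZMod 2) with hA
  let p0 : Fin m := ⟨0, by omega⟩
  let p1 : Fin m := ⟨1, by omega⟩
  let p2 : Fin m := ⟨2, by omega⟩
  let p3 : Fin m := ⟨3, by omega⟩
  have h01 : p0 ≠ p1 := by simp [p0, p1]
  have h02 : p0 ≠ p2 := by simp [p0, p2]
  have h03 : p0 ≠ p3 := by simp [p0, p3]
  have h12 : p1 ≠ p2 := by simp [p1, p2]
  have h13 : p1 ≠ p3 := by simp [p1, p3]
  have h23 : p2 ≠ p3 := by simp [p2, p3]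
  let s := swap p0 p1
  let s' := swap p2 p3
  have hss : s * s = 1 := swap_mul_self _ _
  have hss' : s * s' = s' * s := by
    have := conj_swap' (swap p0 p1) p2 p3
    rw [swap_apply_of_ne_of_ne h02.symm h12.symm, swap_apply_of_ne_of_ne h03.symm h13.symm,
      mul_inv_eq_iff_eq_mul] at this
    exact this
  have hcoc : ∀ f : Perm (Fin m) × Perm (Fin m) → ZMod 2, f ∈ cocycles₂ A ↔
      ∀ g h k, f (g * h, k) + f (g, h) = f (h, k) + f (g, h * k) :=
    fun f => mem_cocycles₂_iff (A := A) f
  have hcob : ∀ f : Perm (Fin m) × Perm (Fin m) → ZMod 2, f ∈ coboundaries₂ A ↔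
      ∃ φ : Perm (Fin m) → ZMod 2, ∀ g h, f (g, h) = φ h - φ (g * h) + φ g := by
    intro f
    constructor
    · rintro ⟨φ, rfl⟩
      exact ⟨φ, fun g h => rfl⟩
    · rintro ⟨φ, h⟩
      exact ⟨φ, funext fun x => (h x.1 x.2).symm⟩
  let v : cocycles₂ A → Perm (Fin m) × Perm (Fin m) → ZMod 2 := fun x => x.1
  let Φ : cocycles₂ A →+ ZMod 2 × ZMod 2 :=
    { toFun := fun x => (v x (s, s) + v x (1, 1), v x (s, s') + v x (s', s))
      map_zero' := rfl
      map_add' := fun x y => by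
        have e : ∀ z, v (x + y) z = v x z + v y z := fun _ => rfl
        simp only [e]
        ext
        · change _ = (_ + _) + (_ + _); ring
        · change _ = (_ + _) + (_ + _); ring }
  have hΦs : Function.Surjective Φ := by
    let x : cocycles₂ A := ⟨fun z => eps z.1 * eps z.2, (hcoc _).2 fun g h k => by
      simp only [eps_mul]; ring⟩
    let y : cocycles₂ A := ⟨fun z => coc z.1 z.2, (hcoc _).2 fun g h k => coc_cocycle g h k⟩
    have es : eps s = 1 := by simp [eps, s, Perm.sign_swap h01]
    have es' : eps s' = 1 := by simp [eps, s', Perm.sign_swap h23]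
    have e1 : eps (1 : Perm (Fin m)) = 0 := by simp [eps]
    have hx : Φ x = (1, 0) := by
      change (eps s * eps s + eps 1 * eps 1, eps s * eps s' + eps s' * eps s) = _
      rw [es, es', e1]; decide
    have hy : (Φ y).2 = 1 := by
      change coc s s' + coc s' s = 1
      rw [coc_swap p0 p1 p2 p3 rfl rfl h02 h03 h12 h13,
        coc_swap p2 p3 p0 p1 rfl rfl h02.symm h12.symm h03.symm h13.symm,
        mu_swap s(p0, p1) s(p2, p3) (by rw [Ne, Sym2.eq_iff]; tauto)]
      linear_combination two (mu s(p0, p1) s(p2, p3))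
    have key : ∀ (a u v : ZMod 2), v = 0 ∨ v = 1 → ∃ i j : ℕ, i • ((1, 0) : ZMod 2 × ZMod 2) +
        j • (a, 1) = (u, v) := by
      intro a u v _
      revert a u v
      have : ∀ (a u v : ZMod 2), (v = 0 ∨ v = 1) → ∃ i j : Fin 2,
        i.val • ((1, 0) : ZMod 2 × ZMod 2) + j.val • (a, 1) = (u, v) := by decide
      intro a u v h
      obtain ⟨i, j, h⟩ := this a u v (by revert v; decide)
      exact ⟨i, j, h⟩
    rintro ⟨u, w⟩
    obtain ⟨i, j, hij⟩ := key (Φ y).1 u w (by revert w; decide)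
    refine ⟨i • x + j • y, ?_⟩
    rw [map_add, map_nsmul, map_nsmul, hx, ← hij, ← hy]
  have hΦk : ∀ x, Φ x = 0 ↔ H2π A x = 0 := by
    intro x
    rw [H2π_eq_zero_iff]
    change _ ↔ v x ∈ coboundaries₂ A
    rw [hcob]
    have hx := (hcoc (v x)).1 x.2
    have hx1 : ∀ g, v x (1, g) = v x (1, 1) := fun g => by
      have := hx 1 1 g
      simp only [one_mul] at this
      linear_combination -this
    have hx2 : ∀ g, v x (g, 1) = v x (1, 1) := fun g => by
      have := hx g 1 1
      simp only [mul_one] at this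
      linear_combination this
    constructor
    · intro h
      have ha : v x (s, s) + v x (1, 1) = 0 := congrArg Prod.fst h
      have hb : v x (s, s') + v x (s', s) = 0 := congrArg Prod.snd h
      obtain ⟨φ, hφ⟩ := isCobound (fun g h => v x (g, h) - v x (1, 1))
        (fun g h k => by linear_combination hx g h k)
        (fun g => by rw [hx1, sub_self]) (fun g => by rw [hx2, sub_self])
        p0 p1 p2 p3 h01 h02 h03 h12 h13 h23
        (by linear_combination ha - two (v x (1, 1)))
        (by linear_combination hb - two (v x (s', s)))
      refine ⟨fun g => φ g + v x (1, 1), fun g h => ?_⟩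
      linear_combination hφ g h
    · rintro ⟨φ, hφ⟩
      apply Prod.ext
      · change v x (s, s) + v x (1, 1) = 0
        rw [hφ, hφ, hss, mul_one]
        linear_combination two (φ s)
      · change v x (s, s') + v x (s', s) = 0
        rw [hφ, hφ, hss']
        linear_combination two (φ s) + two (φ s') - two (φ (s' * s))
  let Ψ : cocycles₂ A →+ groupCohomology A 2 := (H2π A).hom.toAddMonoidHom
  have hΨs : Function.Surjective Ψ := (ModuleCat.epi_iff_surjective (H2π A)).1 inferInstance
  have hker : Ψ.ker = Φ.ker := by
    ext x
    rw [AddMonoidHom.mem_ker, AddMonoidHom.mem_ker, hΦk]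
    rfl
  exact ⟨(QuotientAddGroup.quotientKerEquivOfSurjective Ψ hΨs).symm.trans
    ((QuotientAddGroup.quotientAddEquivOfEq hker).trans
      (QuotientAddGroup.quotientKerEquivOfSurjective Φ hΦs))⟩

end H2Symm


/-- For `m ≥ 4`, the second group cohomology `H²(S_m; ℤ/2)` of the symmetric group
`S_m` with coefficients in `ℤ/2` (with trivial action) is isomorphic to `(ℤ/2) × (ℤ/2)`. -/
theorem h2_symm_zmod2 (m : ℕ) (hm : 4 ≤ m) :
    Nonempty
      ((groupCohomology
          (Rep.trivial ℤ (Equiv.Perm (Fin m)) (ZMod 2)) 2) ≃+ (ZMod 2 × ZMod 2)) := by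
  exact H2Symm.main m hm
end
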